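/- arXiv:1202.4165 — 11 statements merged into one kernel-verified Lean document; each statement's English description precedes it below -/
import Mathlib

section
/- Let H and V be real Hilbert spaces and ι : V → H an injective compact bounded linear operator with dense range. If a bounded linear operator D : V → H is symmetric and self-adjoint, then (a) the orthogonal complement of the range of D in H is contained in ι(V), and (b) there exists a constant c > 0 such that ‖x‖_V ≤ c(‖D x‖_H + ‖ι x‖_H) for all x ∈ V. -/
open scoped RealInnerProductSpace

/-- `D : V → H` is symmetric with respect to the inclusion `ι : V → H`. -/
def IsSymmetricOp {H V : Type*} [NormedAddCommGroup H] [InnerProductSpace ℝ H]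
    [NormedAddCommGroup V] [InnerProductSpace ℝ V]
    (ι : V →L[ℝ] H) (D : V →L[ℝ] H) : Prop :=
  ∀ x ξ : V, ⟪D x, ι ξ⟫ = ⟪ι x, D ξ⟫

/-- `D : V → H` is self-adjoint: it is symmetric, and an element `x ∈ H` lies in `ι(V)`
if and only if the supremum of `|⟨x, D ξ⟩| / ‖ι ξ‖` over `0 ≠ ξ ∈ V` is finite
(equivalently, `|⟨x, D ξ⟩| ≤ C ‖ι ξ‖` for some constant `C`). -/
def IsSelfAdjointOp {H V : Type*} [NormedAddCommGroup H] [InnerProductSpace ℝ H]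
    [NormedAddCommGroup V] [InnerProductSpace ℝ V]
    (ι : V →L[ℝ] H) (D : V →L[ℝ] H) : Prop :=
  IsSymmetricOp ι D ∧
    ∀ x : H, (x ∈ Set.range ι ↔ ∃ C : ℝ, ∀ ξ : V, |⟪x, D ξ⟫| ≤ C * ‖ι ξ‖)

/-- The graph of a self-adjoint operator, as a subset of `H × H`, is the set of pairs satisfying
the weak equation. -/
theorem IsSelfAdjointOp.range_prod_eq {H V : Type*} [NormedAddCommGroup H] [InnerProductSpace ℝ H]
    [NormedAddCommGroup V] [InnerProductSpace ℝ V] {ι D : V →L[ℝ] H}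
    (hD : IsSelfAdjointOp ι D) (hι_dense : DenseRange ι) :
    Set.range (D.prod ι) = ⋂ ξ : V, {p : H × H | ⟪p.2, D ξ⟫ = ⟪p.1, ι ξ⟫} := by
  ext ⟨y, z⟩
  simp only [Set.mem_range, ContinuousLinearMap.prod_apply, Prod.mk.injEq, Set.mem_iInter,
    Set.mem_ofPred_eq]
  refine ⟨?_, fun h => ?_⟩
  · rintro ⟨x, rfl, rfl⟩ ξ
    exact (hD.1 x ξ).symm
  · obtain ⟨x, rfl⟩ := (hD.2 z).2 ⟨‖y‖, fun ξ => by
      rw [h ξ]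
      exact abs_real_inner_le_norm y (ι ξ)⟩
    exact ⟨x, hι_dense.eq_of_inner_left ℝ fun ξ => (hD.1 x ξ).trans (h ξ), rfl⟩

/-- The graph of a self-adjoint operator is closed. -/
theorem IsSelfAdjointOp.isClosed_range_prod {H V : Type*} [NormedAddCommGroup H]
    [InnerProductSpace ℝ H] [NormedAddCommGroup V] [InnerProductSpace ℝ V] {ι D : V →L[ℝ] H}
    (hD : IsSelfAdjointOp ι D) (hι_dense : DenseRange ι) :
    IsClosed (Set.range (D.prod ι)) := by
  rw [hD.range_prod_eq hι_dense]
  exact isClosed_iInter fun ξ => isClosed_eq (by fun_prop) (by fun_prop)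

theorem selfadjoint_implies_semiFredholm_estimate
    {H V : Type*} [NormedAddCommGroup H] [InnerProductSpace ℝ H] [CompleteSpace H]
    [NormedAddCommGroup V] [InnerProductSpace ℝ V] [CompleteSpace V]
    (ι : V →L[ℝ] H) (hι_inj : Function.Injective ι)
    (hι_cpt : IsCompactOperator ι) (hι_dense : DenseRange ι)
    (D : V →L[ℝ] H) (hD : IsSelfAdjointOp ι D) :
    ((LinearMap.range D.toLinearMap)ᗮ ≤ LinearMap.range ι.toLinearMap) ∧
      ∃ c : ℝ, 0 < c ∧ ∀ x : V, ‖x‖ ≤ c * (‖D x‖ + ‖ι x‖) := by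
  refine ⟨fun y hy => (hD.2 y).2 ⟨0, fun ξ => ?_⟩, ?_⟩
  · rw [Submodule.mem_orthogonal'] at hy
    simp [hy (D ξ) ⟨ξ, rfl⟩]
  · have hinj : Function.Injective (D.prod ι) := fun x x' h => hι_inj (congrArg Prod.snd h)
    obtain ⟨K, hK⟩ := (D.prod ι).antilipschitz_of_injective_of_isClosed_range hinj
      (hD.isClosed_range_prod hι_dense)
    refine ⟨K + 1, by positivity, fun x => ?_⟩
    calc ‖x‖ ≤ K * ‖D.prod ι x‖ := hK.le_mul_norm (map_zero _) x
      _ ≤ (K + 1) * (‖D x‖ + ‖ι x‖) := by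
        gcongr
        · linarith
        · exact max_le_add_of_nonneg (norm_nonneg _) (norm_nonneg _)
end

section
/- Let H and V be real Hilbert spaces and ι : V → H an injective compact bounded linear operator with dense range. Let D : V → H be a bounded symmetric linear operator such that the orthogonal complement of the range of D is contained in ι(V), and such that there is a constant c > 0 with ‖x‖_V ≤ c(‖D x‖_H + ‖ι x‖_H) for all x ∈ V. Then the kernel of D is finite dimensional, the range of D is a closed subspace of H, and the orthogonal complement of the range of D equals ι(ker D); in particular D is a Fredholm operator of index zero. -/
open scoped RealInnerProductSpace

section SemiFredholm

variable {V H K : Type*} [NormedAddCommGroup V] [NormedSpace ℝ V]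
  [NormedAddCommGroup H] [NormedSpace ℝ H] [NormedAddCommGroup K] [NormedSpace ℝ K]

/-- The semi-Fredholm estimate says that `x ↦ (D x, ι x)` is bounded below. -/
theorem antilipschitzWith_prod_of_semiFredholm_estimate {D : V →L[ℝ] H} {ι : V →L[ℝ] K} {c : ℝ}
    (hc : 0 ≤ c) (hest : ∀ x, ‖x‖ ≤ c * (‖D x‖ + ‖ι x‖)) :
    AntilipschitzWith (2 * c).toNNReal (D.prod ι) := by
  refine AddMonoidHomClass.antilipschitz_of_bound _ fun x => (hest x).trans ?_
  rw [Real.coe_toNNReal _ (by positivity), mul_comm 2 c, mul_assoc, ContinuousLinearMap.prod_apply,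
    Prod.norm_mk]
  gcongr
  linarith [le_max_left ‖D x‖ ‖ι x‖, le_max_right ‖D x‖ ‖ι x‖]

/-- A normed space with a compact operator that is bounded below is finite dimensional. -/
theorem IsCompactOperator.finiteDimensional_of_antilipschitzWith {f : V →L[ℝ] K}
    (hf : IsCompactOperator f) {C : NNReal} (hC : AntilipschitzWith C f) :
    FiniteDimensional ℝ V := by
  obtain ⟨S, hS, hsub⟩ := hf.image_closedBall_subset_compact (f := f.toLinearMap) 1
  refine FiniteDimensional.of_totallyBounded_nhds_zero (𝕜 := ℝ)
    (Metric.closedBall_mem_nhds (0 : V) one_pos) ?_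
  exact (totallyBounded_preimage (hC.isUniformInducing f.uniformContinuous)
    hS.totallyBounded).subset (Set.image_subset_iff.mp hsub)

/-- The semi-Fredholm estimate with compact remainder forces the kernel to be finite dimensional. -/
theorem finiteDimensional_ker_of_semiFredholm_estimate {D : V →L[ℝ] H} {ι : V →L[ℝ] K}
    (hι : IsCompactOperator ι) {c : ℝ} (hc : 0 ≤ c)
    (hest : ∀ x, ‖x‖ ≤ c * (‖D x‖ + ‖ι x‖)) :
    FiniteDimensional ℝ (LinearMap.ker D.toLinearMap) := by
  set N := LinearMap.ker D.toLinearMap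
  have hcpt : IsCompactOperator (ι.comp N.subtypeL) := hι.comp_clm N.subtypeL
  refine hcpt.finiteDimensional_of_antilipschitzWith (C := c.toNNReal)
    (AddMonoidHomClass.antilipschitz_of_bound _ fun x => ?_)
  have hx : D x = 0 := x.2
  simpa [hx, hc] using hest x

/-- If the semi-Fredholm estimate holds with compact remainder, then `D` is bounded below on every
closed subspace that meets the kernel trivially. -/
theorem exists_bound_of_semiFredholm_estimate [CompleteSpace V] {D : V →L[ℝ] H} {ι : V →L[ℝ] K}
    (hι : IsCompactOperator ι) {c : ℝ} (hc : 0 ≤ c)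
    (hest : ∀ x, ‖x‖ ≤ c * (‖D x‖ + ‖ι x‖)) {W : Submodule ℝ V} (hW : IsClosed (W : Set V))
    (hdisj : ∀ w ∈ W, D w = 0 → w = 0) :
    ∃ C : ℝ, 0 ≤ C ∧ ∀ w ∈ W, ‖w‖ ≤ C * ‖D w‖ := by
  by_contra! hcon
  have hunit : ∀ n : ℕ, ∃ u ∈ W, ‖u‖ = 1 ∧ ‖D u‖ ≤ 1 / ((n : ℝ) + 1) := by
    intro n
    obtain ⟨w, hwW, hw⟩ := hcon ((n : ℝ) + 1) (by positivity)
    have hpos : 0 < ‖w‖ := lt_of_le_of_lt (by positivity) hw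
    refine ⟨‖w‖⁻¹ • w, W.smul_mem _ hwW, by simp [norm_smul, hpos.ne'], ?_⟩
    rw [map_smul, norm_smul, norm_inv, norm_norm, inv_mul_le_iff₀ hpos, mul_one_div,
      le_div_iff₀ (by positivity)]
    linarith
  choose u huW hu1 huD using hunit
  have hD : Filter.Tendsto (fun n => D (u n)) Filter.atTop (nhds 0) :=
    squeeze_zero_norm huD tendsto_one_div_add_atTop_nhds_zero_nat
  obtain ⟨S, hS, hsub⟩ := hι.image_closedBall_subset_compact (f := ι.toLinearMap) 1
  obtain ⟨h, -, φ, hφ, hlim⟩ := hS.tendsto_subseq (x := fun n => ι (u n)) fun n =>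
    hsub ⟨u n, by simp [hu1 n], rfl⟩
  have hemb := (antilipschitzWith_prod_of_semiFredholm_estimate hc hest).isClosedEmbedding
    (D.prod ι).uniformContinuous
  have hprod : Filter.Tendsto (fun n => D.prod ι (u (φ n))) Filter.atTop (nhds (0, h)) :=
    (hD.comp hφ.tendsto_atTop).prodMk_nhds hlim
  obtain ⟨w, hw⟩ := hemb.isClosed_range.mem_of_tendsto hprod (.of_forall fun n => ⟨_, rfl⟩)
  have huw : Filter.Tendsto (fun n => u (φ n)) Filter.atTop (nhds w) :=
    hemb.isInducing.tendsto_nhds_iff.mpr (hw ▸ hprod)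
  have hw0 : w = 0 :=
    hdisj w (hW.mem_of_tendsto huw (.of_forall fun n => huW _)) (congrArg Prod.fst hw)
  have hw1 : ‖w‖ = 1 := tendsto_nhds_unique huw.norm (by simp [hu1])
  simp [hw0] at hw1

end SemiFredholm

/-- On a Hilbert space, the semi-Fredholm estimate with compact remainder implies closed range. -/
theorem isClosed_range_of_semiFredholm_estimate {V H K : Type*}
    [NormedAddCommGroup V] [InnerProductSpace ℝ V] [CompleteSpace V]
    [NormedAddCommGroup H] [NormedSpace ℝ H] [NormedAddCommGroup K] [NormedSpace ℝ K]
    {D : V →L[ℝ] H} {ι : V →L[ℝ] K} (hι : IsCompactOperator ι) {c : ℝ} (hc : 0 ≤ c)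
    (hest : ∀ x, ‖x‖ ≤ c * (‖D x‖ + ‖ι x‖)) : IsClosed (Set.range D) := by
  set N := LinearMap.ker D.toLinearMap
  have hN : IsClosed (N : Set V) := D.isClosed_ker
  have : CompleteSpace N := hN.completeSpace_coe
  have : CompleteSpace Nᗮ := N.isClosed_orthogonal.completeSpace_coe
  obtain ⟨C, hC, hbound⟩ := exists_bound_of_semiFredholm_estimate hι hc hest
    N.isClosed_orthogonal fun w hw hDw =>
      (Submodule.mem_bot ℝ).mp (N.inf_orthogonal_eq_bot ▸ ⟨hDw, hw⟩)
  have hanti : AntilipschitzWith C.toNNReal (D.comp Nᗮ.subtypeL) :=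
    AddMonoidHomClass.antilipschitz_of_bound _ fun w => by
      simpa [hC] using hbound w w.2
  convert hanti.isClosed_range (D.comp Nᗮ.subtypeL).uniformContinuous using 1
  refine subset_antisymm ?_ (Set.range_comp_subset_range _ D)
  rintro _ ⟨x, rfl⟩
  obtain ⟨y, hy, z, hz, rfl⟩ := N.exists_add_mem_mem_orthogonal x
  have hDy : D y = 0 := hy
  exact ⟨⟨z, hz⟩, by simp [hDy]⟩

/-- The image under `ι` of the kernel of a symmetric operator is the part of `ι(V)` orthogonal to
its range. -/
theorem IsSymmetricOp.map_mem_orthogonal_range_iff {H V : Type*}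
    [NormedAddCommGroup H] [InnerProductSpace ℝ H] [NormedAddCommGroup V] [InnerProductSpace ℝ V]
    {ι D : V →L[ℝ] H} (hsym : IsSymmetricOp ι D) (hι : DenseRange ι) (x : V) :
    ι x ∈ (LinearMap.range D.toLinearMap)ᗮ ↔ D x = 0 := by
  rw [Submodule.mem_orthogonal]
  refine ⟨fun hx => ?_, ?_⟩
  · exact hι.eq_zero_of_inner_left ℝ fun ξ =>
      (hsym x ξ).trans ((real_inner_comm _ _).trans (hx (D ξ) ⟨ξ, rfl⟩))
  · rintro hx _ ⟨ξ, rfl⟩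
    exact (hsym ξ x).trans (by simp [hx])

/-- A symmetric operator satisfying the semi-Fredholm estimate and whose cokernel consists of
elements of `ι(V)` has finite dimensional kernel, closed range, the orthogonal complement of the
range equals `ι(ker D)`; in particular `D` is a Fredholm operator of index zero. -/
theorem symmetric_estimate_implies_fredholm_index_zero
    {H V : Type*} [NormedAddCommGroup H] [InnerProductSpace ℝ H] [CompleteSpace H]
    [NormedAddCommGroup V] [InnerProductSpace ℝ V] [CompleteSpace V]
    (ι : V →L[ℝ] H) (hι_inj : Function.Injective ι)
    (hι_cpt : IsCompactOperator ι) (hι_dense : DenseRange ι)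
    (D : V →L[ℝ] H) (hsym : IsSymmetricOp ι D)
    (hperp : (LinearMap.range D.toLinearMap)ᗮ ≤ LinearMap.range ι.toLinearMap)
    (c : ℝ) (hc : 0 < c) (hest : ∀ x : V, ‖x‖ ≤ c * (‖D x‖ + ‖ι x‖)) :
    FiniteDimensional ℝ (LinearMap.ker D.toLinearMap) ∧
      IsClosed (Set.range D) ∧
      (LinearMap.range D.toLinearMap)ᗮ =
        Submodule.map ι.toLinearMap (LinearMap.ker D.toLinearMap) := by
  refine ⟨finiteDimensional_ker_of_semiFredholm_estimate hι_cpt hc.le hest,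
    isClosed_range_of_semiFredholm_estimate hι_cpt hc.le hest, le_antisymm (fun y hy => ?_) ?_⟩
  · obtain ⟨x, rfl⟩ := hperp hy
    exact ⟨x, (hsym.map_mem_orthogonal_range_iff hι_dense x).mp hy, rfl⟩
  · rintro _ ⟨x, hx, rfl⟩
    exact (hsym.map_mem_orthogonal_range_iff hι_dense x).mpr hx
end

section
/- Let H and V be real Hilbert spaces and ι : V → H an injective compact bounded linear operator with dense range. Let D : V → H be a bounded symmetric linear operator that is Fredholm of index zero, i.e. its kernel is finite dimensional, its range is closed, and the dimension of the orthogonal complement of its range equals the dimension of its kernel. Then D is self-adjoint: for every x ∈ H, if there is a constant c with |⟨x, D ξ⟩_H| ≤ c ‖ι ξ‖_H for all ξ ∈ V, then x ∈ ι(V). -/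
open scoped RealInnerProductSpace

/-- A linear functional bounded by `c ‖ι ξ‖` is represented by a vector through `ι`. -/
theorem exists_inner_eq_of_abs_le {H V : Type*} [NormedAddCommGroup H] [InnerProductSpace ℝ H]
    [CompleteSpace H] [AddCommGroup V] [Module ℝ V]
    (ι : V →ₗ[ℝ] H) (hι : Function.Injective ι) (f : V →ₗ[ℝ] ℝ) (c : ℝ)
    (hf : ∀ ξ, |f ξ| ≤ c * ‖ι ξ‖) : ∃ y : H, ∀ ξ, f ξ = ⟪y, ι ξ⟫ := by
  let e := LinearEquiv.ofInjective ι hι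
  have he (z : LinearMap.range ι) : ι (e.symm z) = z :=
    congrArg Subtype.val (e.apply_symm_apply z)
  let g : StrongDual ℝ (LinearMap.range ι) :=
    (f ∘ₗ e.symm.toLinearMap).mkContinuous c fun z => by
      simpa [he] using hf (e.symm z)
  obtain ⟨G, hG, -⟩ := exists_extension_norm_eq (LinearMap.range ι) g
  refine ⟨(InnerProductSpace.toDual ℝ H).symm G, fun ξ => ?_⟩
  rw [InnerProductSpace.toDual_symm_apply]
  calc f ξ = g (e ξ) := by simp [g]
    _ = G (ι ξ) := (hG (e ξ)).symm

/-- If a symmetric operator has index zero, the orthogonal complement of its range is the image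
of its kernel. -/
theorem IsSymmetricOp.map_ker_eq_orthogonal_range {H V : Type*}
    [NormedAddCommGroup H] [InnerProductSpace ℝ H]
    [NormedAddCommGroup V] [InnerProductSpace ℝ V]
    {ι D : V →L[ℝ] H} (hsym : IsSymmetricOp ι D) (hι : Function.Injective ι)
    [FiniteDimensional ℝ ((LinearMap.range D.toLinearMap)ᗮ)]
    (hindex : Module.finrank ℝ ((LinearMap.range D.toLinearMap)ᗮ) =
      Module.finrank ℝ (LinearMap.ker D.toLinearMap)) :
    (LinearMap.ker D.toLinearMap).map ι.toLinearMap = (LinearMap.range D.toLinearMap)ᗮ := by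
  apply Submodule.eq_of_le_of_finrank_eq
  · rintro _ ⟨v, hv, rfl⟩
    rw [Submodule.mem_orthogonal']
    rintro _ ⟨ξ, rfl⟩
    have hv' : D v = 0 := hv
    simpa [hv'] using (hsym v ξ).symm
  · rw [hindex]
    exact (Submodule.equivMapOfInjective ι.toLinearMap hι _).finrank_eq.symm

/-- A symmetric Fredholm operator of index zero (finite dimensional kernel, closed range, and
the dimension of the orthogonal complement of the range equal to the dimension of the kernel)
is self-adjoint: any `x ∈ H` against which `ξ ↦ ⟨x, D ξ⟩` is bounded by `c ‖ι ξ‖`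
lies in `ι(V)`. -/
theorem symmetric_fredholm_index_zero_implies_selfadjoint
    {H V : Type*} [NormedAddCommGroup H] [InnerProductSpace ℝ H] [CompleteSpace H]
    [NormedAddCommGroup V] [InnerProductSpace ℝ V] [CompleteSpace V]
    (ι : V →L[ℝ] H) (hι_inj : Function.Injective ι)
    (hι_cpt : IsCompactOperator ι) (hι_dense : DenseRange ι)
    (D : V →L[ℝ] H) (hsym : IsSymmetricOp ι D)
    (hker : FiniteDimensional ℝ (LinearMap.ker D.toLinearMap))
    (hclosed : IsClosed (Set.range D))
    (hcoker : FiniteDimensional ℝ ((LinearMap.range D.toLinearMap)ᗮ))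
    (hindex : Module.finrank ℝ ((LinearMap.range D.toLinearMap)ᗮ) =
      Module.finrank ℝ (LinearMap.ker D.toLinearMap)) :
    ∀ x : H, (∃ c : ℝ, ∀ ξ : V, |⟪x, D ξ⟫| ≤ c * ‖ι ξ‖) → x ∈ Set.range ι := by
  rintro x ⟨c, hc⟩
  have hmap := hsym.map_ker_eq_orthogonal_range hι_inj hindex
  obtain ⟨y, hy⟩ := exists_inner_eq_of_abs_le ι.toLinearMap hι_inj
    ((innerSL ℝ x).toLinearMap ∘ₗ D.toLinearMap) c hc
  replace hy (ξ : V) : ⟪x, D ξ⟫ = ⟪y, ι ξ⟫ := hy ξ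
  have hyD : y ∈ LinearMap.range D.toLinearMap := by
    have hR : IsClosed (LinearMap.range D.toLinearMap : Set H) := hclosed
    rw [← hR.submodule_topologicalClosure_eq, ← Submodule.orthogonal_orthogonal_eq_closure,
      ← hmap, Submodule.mem_orthogonal']
    rintro _ ⟨v, hv, rfl⟩
    have hv' : D v = 0 := hv
    simpa [hv'] using (hy v).symm
  obtain ⟨v, rfl⟩ := hyD
  have hx : x - ι v ∈ (LinearMap.range D.toLinearMap)ᗮ := by
    rw [Submodule.mem_orthogonal']
    rintro _ ⟨ξ, rfl⟩
    have h : ⟪x, D ξ⟫ = ⟪ι v, D ξ⟫ := (hy ξ).trans (hsym v ξ)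
    simp [inner_sub_left, h]
  rw [← hmap] at hx
  obtain ⟨w, -, hw⟩ := hx
  exact ⟨w + v, by rw [map_add]; exact eq_sub_iff_add_eq.mp hw⟩
end

section
/- Let H and V be real Hilbert spaces and ι : V → H an injective compact bounded linear operator with dense range. The set of self-adjoint operators is open in the set of symmetric operators with respect to the operator norm: if D : V → H is a bounded symmetric self-adjoint operator, then there exists ε > 0 such that every bounded symmetric operator D' : V → H with operator norm ‖D' − D‖ < ε is self-adjoint. -/
open scoped RealInnerProductSpace

section

variable {H V : Type*} [NormedAddCommGroup H] [InnerProductSpace ℝ H]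
  [NormedAddCommGroup V] [InnerProductSpace ℝ V] {ι D : V →L[ℝ] H}

/-- The graph of a self-adjoint operator is closed. -/
lemma IsSelfAdjointOp.isClosed_range_prod_s3 (hι : DenseRange ι) (hD : IsSelfAdjointOp ι D) :
    IsClosed (Set.range (ι.prod D)) := by
  obtain ⟨hsymm, hdom⟩ := hD
  have hgraph : Set.range (ι.prod D) = {p : H × H | ∀ ξ, ⟪p.1, D ξ⟫ = ⟪p.2, ι ξ⟫} := by
    ext ⟨x, y⟩
    constructor
    · rintro ⟨η, hη⟩ ξ
      obtain ⟨rfl, rfl⟩ := Prod.mk.inj hη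
      exact (hsymm η ξ).symm
    · intro (h : ∀ ξ, ⟪x, D ξ⟫ = ⟪y, ι ξ⟫)
      obtain ⟨η, rfl⟩ := (hdom x).2 ⟨‖y‖, fun ξ ↦ h ξ ▸ abs_real_inner_le_norm y (ι ξ)⟩
      refine ⟨η, Prod.ext rfl (hι.eq_of_inner_left ℝ fun ξ ↦ ?_)⟩
      exact (hsymm η ξ).trans (h ξ)
  rw [hgraph, Set.ofPred_forall]
  exact isClosed_iInter fun ξ ↦ isClosed_eq (by fun_prop) (by fun_prop)

/-- The graph inner product on `V` of a self-adjoint operator is coercive. -/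
lemma IsSelfAdjointOp.isCoercive [CompleteSpace H] [CompleteSpace V]
    (hι_inj : Function.Injective ι) (hι : DenseRange ι) (hD : IsSelfAdjointOp ι D) :
    IsCoercive ((innerSL ℝ).bilinearComp D D + (innerSL ℝ).bilinearComp ι ι) := by
  obtain ⟨K, hK⟩ := (ι.prod D).antilipschitz_of_injective_of_isClosed_range
    (fun _ _ h ↦ hι_inj (congrArg Prod.fst h)) (hD.isClosed_range_prod_s3 hι)
  refine ⟨((K : ℝ) ^ 2 + 1)⁻¹, by positivity, fun η ↦ ?_⟩
  have hη : ‖η‖ ≤ K * max ‖ι η‖ ‖D η‖ := by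
    simpa [Prod.norm_def] using! hK.le_mul_norm (map_zero _) η
  have hmax : max ‖ι η‖ ‖D η‖ ^ 2 ≤ ‖D η‖ ^ 2 + ‖ι η‖ ^ 2 := by
    rcases max_choice ‖ι η‖ ‖D η‖ with h | h <;> rw [h] <;>
      nlinarith [sq_nonneg ‖ι η‖, sq_nonneg ‖D η‖]
  have hB : ((innerSL ℝ).bilinearComp D D + (innerSL ℝ).bilinearComp ι ι) η η
      = ‖D η‖ ^ 2 + ‖ι η‖ ^ 2 := by simp
  rw [hB, mul_assoc, inv_mul_le_iff₀ (by positivity), ← sq]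
  calc ‖η‖ ^ 2 ≤ (K * max ‖ι η‖ ‖D η‖) ^ 2 := by gcongr
    _ = (K : ℝ) ^ 2 * max ‖ι η‖ ‖D η‖ ^ 2 := mul_pow _ _ _
    _ ≤ (K : ℝ) ^ 2 * (‖D η‖ ^ 2 + ‖ι η‖ ^ 2) := by gcongr
    _ ≤ ((K : ℝ) ^ 2 + 1) * (‖D η‖ ^ 2 + ‖ι η‖ ^ 2) := by gcongr; linarith

/-- The operator `ι + i D` between the complexifications of `V` and `H`, in real coordinates. -/
def complexShift (ι D : V →L[ℝ] H) : V × V →L[ℝ] H × H :=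
  (ι.coprod (-D)).prod (D.coprod ι)

@[simp]
lemma complexShift_apply (ι D : V →L[ℝ] H) (p : V × V) :
    complexShift ι D p = (ι p.1 - D p.2, D p.1 + ι p.2) := by
  simp [complexShift, sub_eq_add_neg]

lemma continuous_complexShift (ι : V →L[ℝ] H) : Continuous (complexShift ι) := by
  have h : complexShift ι = fun D ↦ complexShift ι 0 +
      (-(ContinuousLinearMap.inl ℝ H H ∘L D ∘L ContinuousLinearMap.snd ℝ V V) +
        ContinuousLinearMap.inr ℝ H H ∘L D ∘L ContinuousLinearMap.fst ℝ V V) := by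
    funext D
    ext p <;> simp
  rw [h]
  fun_prop

lemma IsSymmetricOp.injective_complexShift (hι_inj : Function.Injective ι)
    (hD : IsSymmetricOp ι D) : Function.Injective (complexShift ι D) := by
  rw [injective_iff_map_eq_zero]
  rintro ⟨ξ, η⟩ h
  simp only [complexShift_apply, Prod.mk_eq_zero] at h
  obtain ⟨h₁, h₂⟩ := h
  have h₁ : ι ξ = D η := sub_eq_zero.1 h₁
  have h₂ : ι η = -D ξ := (neg_eq_of_add_eq_zero_right h₂).symm
  have hsum : ⟪ι ξ, ι ξ⟫ + ⟪ι η, ι η⟫ = 0 := by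
    nth_rw 2 [h₁]
    nth_rw 1 [h₂]
    rw [inner_neg_left, hD ξ η, add_neg_cancel]
  have hξ : ι ξ = 0 := inner_self_eq_zero.1 <| le_antisymm
    (by linarith [real_inner_self_nonneg (x := ι η)]) real_inner_self_nonneg
  have hη : ι η = 0 := inner_self_eq_zero.1 <| le_antisymm
    (by linarith [real_inner_self_nonneg (x := ι ξ)]) real_inner_self_nonneg
  exact Prod.ext ((map_eq_zero_iff ι hι_inj).1 hξ) ((map_eq_zero_iff ι hι_inj).1 hη)

lemma IsSelfAdjointOp.surjective_complexShift [CompleteSpace H] [CompleteSpace V]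
    (hι_inj : Function.Injective ι) (hι : DenseRange ι) (hD : IsSelfAdjointOp ι D) :
    Function.Surjective (complexShift ι D) := by
  rintro ⟨x, y⟩
  have hB := hD.isCoercive hι_inj hι
  obtain ⟨η, hη⟩ := hB.continuousLinearEquivOfBilin.surjective (ι.adjoint y - D.adjoint x)
  have hweak (ζ : V) : ⟪x + D η, D ζ⟫ = ⟪y - ι η, ι ζ⟫ := by
    have h := hB.continuousLinearEquivOfBilin_apply η ζ
    rw [hη] at h
    simp only [inner_sub_left, ContinuousLinearMap.adjoint_inner_left,
      add_apply, ContinuousLinearMap.bilinearComp_apply,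
      innerSL_apply_apply] at h
    rw [inner_add_left, inner_sub_left]
    linarith
  obtain ⟨ξ, hξ⟩ := (hD.2 (x + D η)).2
    ⟨‖y - ι η‖, fun ζ ↦ hweak ζ ▸ abs_real_inner_le_norm _ _⟩
  have hDξ : D ξ = y - ι η := hι.eq_of_inner_left ℝ fun ζ ↦ by
    rw [hD.1 ξ ζ, hξ, hweak ζ]
  exact ⟨(ξ, η), by simp [hξ, hDξ]⟩

/-- A functional bounded with respect to `‖ι ·‖` is represented by a vector of `H`. -/
lemma DenseRange.exists_inner_eq [CompleteSpace H] (hι : DenseRange ι) (f : V →L[ℝ] ℝ)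
    (hf : ∃ C : ℝ, ∀ ξ, |f ξ| ≤ C * ‖ι ξ‖) : ∃ y : H, ∀ ξ, f ξ = ⟪y, ι ξ⟫ := by
  refine ⟨(InnerProductSpace.toDual ℝ H).symm
    (f.toLinearMap.extendOfNorm ι.toLinearMap), fun ξ ↦ ?_⟩
  rw [InnerProductSpace.toDual_symm_apply]
  exact (LinearMap.extendOfNorm_eq (f := f.toLinearMap) (e := ι.toLinearMap) hι hf ξ).symm

lemma IsSymmetricOp.isSelfAdjointOp_of_surjective [CompleteSpace H]
    (hι_inj : Function.Injective ι) (hι : DenseRange ι) (hD : IsSymmetricOp ι D)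
    (hsurj : Function.Surjective (complexShift ι D)) : IsSelfAdjointOp ι D := by
  refine ⟨hD, fun x ↦ ⟨?_, fun hx ↦ ?_⟩⟩
  · rintro ⟨ζ, rfl⟩
    exact ⟨‖D ζ‖, fun ξ ↦ hD ζ ξ ▸ abs_real_inner_le_norm _ _⟩
  · obtain ⟨y, hy⟩ := hι.exists_inner_eq (innerSL ℝ x ∘L D) hx
    obtain ⟨⟨ξ, η⟩, h⟩ := hsurj (x, y)
    rw [complexShift_apply] at h
    obtain ⟨rfl, rfl⟩ := Prod.mk.inj h
    have hη : ⟪ι ξ - D η, D η⟫ = ⟪D ξ + ι η, ι η⟫ := hy η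
    rw [inner_sub_left, inner_add_left, hD ξ η] at hη
    have hιη : ι η = 0 := inner_self_eq_zero.1 <| le_antisymm
      (by linarith [real_inner_self_nonneg (x := D η)]) real_inner_self_nonneg
    have hη₀ : η = 0 := (map_eq_zero_iff ι hι_inj).1 hιη
    exact ⟨ξ, by simp [hη₀]⟩

end

/-- The set of self-adjoint operators is open in the set of symmetric operators with respect
to the operator norm. -/
theorem selfadjoint_open_in_symmetric
    {H V : Type*} [NormedAddCommGroup H] [InnerProductSpace ℝ H] [CompleteSpace H]
    [NormedAddCommGroup V] [InnerProductSpace ℝ V] [CompleteSpace V]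
    (ι : V →L[ℝ] H) (hι_inj : Function.Injective ι)
    (hι_cpt : IsCompactOperator ι) (hι_dense : DenseRange ι)
    (D : V →L[ℝ] H) (hD : IsSelfAdjointOp ι D) :
    ∃ ε : ℝ, 0 < ε ∧ ∀ D' : V →L[ℝ] H,
      IsSymmetricOp ι D' → ‖D' - D‖ < ε → IsSelfAdjointOp ι D' := by
  let e : (V × V) ≃L[ℝ] (H × H) := ContinuousLinearEquiv.ofBijective (complexShift ι D)
    (LinearMap.ker_eq_bot.2 (hD.1.injective_complexShift hι_inj))
    (LinearMap.range_eq_top.2 (hD.surjective_complexShift hι_inj hι_dense))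
  have he : (e : V × V →L[ℝ] H × H) = complexShift ι D :=
    ContinuousLinearEquiv.coe_ofBijective _ _ _
  have hnhds := (continuous_complexShift ι).continuousAt.preimage_mem_nhds (he ▸ e.nhds)
  obtain ⟨ε, hε, hball⟩ := Metric.mem_nhds_iff.1 hnhds
  refine ⟨ε, hε, fun D' hD' hlt ↦ ?_⟩
  obtain ⟨e', he'⟩ := hball (mem_ball_iff_norm.2 hlt)
  refine hD'.isSelfAdjointOp_of_surjective hι_inj hι_dense ?_
  rw [← he']
  exact e'.surjective
end

section
/- Let S : ℝ³ × ℝ³ → ℝ³ be a skew-symmetric bilinear map, let E ⊆ ℝ³ be a 2-dimensional linear subspace, let λ : E → End(ℝ³) be a linear map, and let ℒ be the set of linear maps L : ℝ³ → End(ℝ³) whose restriction to E equals λ. If ℒ ∩ R is nonempty, then ℒ ∩ R has exactly two connected components, and the convex hull of each connected component of ℒ ∩ R is equal to ℒ. -/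
open scoped RealInnerProductSpace

noncomputable section

/-- `ℝ³` as a Euclidean space. -/
abbrev V3 : Type := EuclideanSpace ℝ (Fin 3)

/-- The space `End(ℝ³)` of linear endomorphisms of `ℝ³` (as continuous linear maps,
which is no restriction in finite dimensions and carries the norm topology). -/
abbrev End3 : Type := V3 →L[ℝ] V3

/-- The space `Hom(ℝ³, End(ℝ³))`. -/
abbrev Hom3 : Type := V3 →L[ℝ] End3

/-- The standard basis vectors of `ℝ³`. -/
def e1 : V3 := EuclideanSpace.single 0 1
def e2 : V3 := EuclideanSpace.single 1 1
def e3 : V3 := EuclideanSpace.single 2 1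

/-- The skew-symmetric bilinear map `T_L(u,v) = S(u,v) + L(u)v - L(v)u`. -/
def TT (S : V3 →ₗ[ℝ] V3 →ₗ[ℝ] V3) (L : Hom3) (u v : V3) : V3 :=
  S u v + L u v - L v u

/-- The open set `R` of linear maps `L : ℝ³ → End(ℝ³)` satisfying the nondegeneracy
condition: the only `w` orthogonal to all values `T_L(u,v)` is `w = 0`. -/
def RSet (S : V3 →ₗ[ℝ] V3 →ₗ[ℝ] V3) : Set Hom3 :=
  {L | ∀ w : V3, (∀ u v : V3, ⟪w, TT S L u v⟫ = 0) → w = 0}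

/-- The determinant of the `3 × 3` matrix with columns `a`, `b`, `c`. -/
def det3 (a b c : V3) : ℝ :=
  Matrix.det (Matrix.of fun i j => (![a, b, c] j) i)

/-- The affine subspace `ℒ` of linear maps `ℝ³ → End(ℝ³)` restricting to `Λ` on `E`. -/
def LSet (E : Submodule ℝ V3) (Λ : E →ₗ[ℝ] End3) : Set Hom3 :=
  {L | ∀ x : E, L (x : V3) = Λ x}

end

section AlternatingForm

variable {V : Type*} [AddCommGroup V] [Module ℝ V]

/-- The pairs of vectors on which the bilinear form `ω` is positive. -/
def positivePairs (ω : V →ₗ[ℝ] V →ₗ[ℝ] ℝ) : Set (V × V) :=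
  {p | 0 < ω p.1 p.2}

theorem positivePairs_nonempty {ω : V →ₗ[ℝ] V →ₗ[ℝ] ℝ} (hω : ω ≠ 0) :
    (positivePairs ω).Nonempty := by
  obtain ⟨x, y, hxy⟩ : ∃ x y, ω x y ≠ 0 := by
    by_contra! h
    exact hω (LinearMap.ext₂ h)
  rcases hxy.lt_or_gt with h | h
  · exact ⟨(-x, y), by simpa [positivePairs] using h⟩
  · exact ⟨(x, y), h⟩

theorem convexHull_positivePairs {ω : V →ₗ[ℝ] V →ₗ[ℝ] ℝ} (hω : ω ≠ 0) :
    convexHull ℝ (positivePairs ω) = Set.univ := by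
  obtain ⟨⟨x, y⟩, hxy⟩ := positivePairs_nonempty hω
  replace hxy : 0 < ω x y := hxy
  refine Set.eq_univ_of_forall fun ⟨a, b⟩ => ?_
  set A := ω a b
  set B := ω a y + ω x b
  obtain ⟨s, hs₁, hs₂⟩ : ∃ s : ℝ, 0 < A + s * B + s ^ 2 * ω x y ∧
      0 < A - s * B + s ^ 2 * ω x y := by
    set k := ω x y
    set s := 1 + (|A| + |B|) / k
    have hs : s * k = k + |A| + |B| := by simp only [s]; field_simp; ring
    have hs1 : 1 ≤ s := by
      have : 0 ≤ (|A| + |B|) / k := by positivity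
      simp only [s]; linarith
    have h2 : s ^ 2 * k = s * (k + |A| + |B|) := by rw [← hs]; ring
    have h3 : k + |A| ≤ s * (k + |A|) := le_mul_of_one_le_left (by positivity) hs1
    have h4 : s * B ≤ s * |B| := by gcongr; exact le_abs_self B
    have h5 : s * (-B) ≤ s * |B| := by gcongr; exact neg_le_abs B
    have h6 := neg_abs_le A
    exact ⟨s, by linarith, by linarith⟩
  have hmid : ((a, b) : V × V) =
      (1 / 2 : ℝ) • (a + s • x, b + s • y) + (1 / 2 : ℝ) • (a - s • x, b - s • y) := by
    ext <;> simp <;> module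
  rw [hmid]
  refine convex_convexHull ℝ _ (subset_convexHull ℝ _ ?_) (subset_convexHull ℝ _ ?_)
    (by norm_num) (by norm_num) (by norm_num)
  · simp only [positivePairs, Set.mem_ofPred_eq, map_add, map_smul, LinearMap.add_apply,
      LinearMap.smul_apply, smul_eq_mul]
    convert hs₁ using 1
    simp only [A, B]; ring
  · simp only [positivePairs, Set.mem_ofPred_eq, map_sub, map_smul, LinearMap.sub_apply,
      LinearMap.smul_apply, smul_eq_mul]
    convert hs₂ using 1
    simp only [A, B]; ring

variable [TopologicalSpace V] [IsTopologicalAddGroup V] [ContinuousSMul ℝ V]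

theorem joinedIn_of_convex {s : Set V} (hs : Convex ℝ s) {x y : V} (hx : x ∈ s) (hy : y ∈ s) :
    JoinedIn s x y :=
  (hs.isPathConnected ⟨x, hx⟩).joinedIn x hx y hy

theorem joinedIn_positivePairs_left {ω : V →ₗ[ℝ] V →ₗ[ℝ] ℝ} {a a' b : V}
    (h : 0 < ω a b) (h' : 0 < ω a' b) : JoinedIn (positivePairs ω) (a, b) (a', b) := by
  have hc : Convex ℝ {x : V | 0 < ω.flip b x} := convex_halfSpace_gt (ω.flip b).isLinear 0
  refine ((joinedIn_of_convex hc h h').map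
    (f := fun x => (x, b)) (by fun_prop)).mono ?_
  rintro _ ⟨x, hx, rfl⟩
  exact hx

theorem joinedIn_positivePairs_right {ω : V →ₗ[ℝ] V →ₗ[ℝ] ℝ} {a b b' : V}
    (h : 0 < ω a b) (h' : 0 < ω a b') : JoinedIn (positivePairs ω) (a, b) (a, b') := by
  have hc : Convex ℝ {x : V | 0 < ω a x} := convex_halfSpace_gt (ω a).isLinear 0
  refine ((joinedIn_of_convex hc h h').map
    (f := fun x => (a, x)) (by fun_prop)).mono ?_
  rintro _ ⟨x, hx, rfl⟩
  exact hx

/-- A quarter turn in the plane of a positive pair is a composite of three shears. -/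
theorem joinedIn_positivePairs_quarterTurn {ω : V →ₗ[ℝ] V →ₗ[ℝ] ℝ} (halt : ω.IsAlt) {a b : V}
    (h : 0 < ω a b) : JoinedIn (positivePairs ω) (a, b) (b, -a) := by
  have hba : ω b a = -ω a b := (halt.neg a b).symm
  have h₁ : 0 < ω (a + b) b := by simpa [halt.self_eq_zero] using h
  have h₂ : 0 < ω (a + b) (-a) := by simpa [halt.self_eq_zero, hba] using h
  have h₃ : 0 < ω b (-a) := by simpa [hba] using h
  exact ((joinedIn_positivePairs_left h h₁).trans (joinedIn_positivePairs_right h₁ h₂)).trans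
    (joinedIn_positivePairs_left h₂ h₃)

theorem joinedIn_positivePairs_of_ne_zero {ω : V →ₗ[ℝ] V →ₗ[ℝ] ℝ} (halt : ω.IsAlt)
    {a b a' b' : V} (h : 0 < ω a b) (h' : 0 < ω a' b') (hne : ω a' b ≠ 0) :
    JoinedIn (positivePairs ω) (a, b) (a', b') := by
  rcases hne.lt_or_gt with hlt | hgt
  · have h₁ : 0 < ω b (-a) := by simpa [← halt.neg a b] using h
    have h₂ : 0 < ω (-a) (-b) := by simpa using h
    have h₃ : 0 < ω a' (-b) := by simpa using hlt
    exact (((joinedIn_positivePairs_quarterTurn halt h).trans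
      (joinedIn_positivePairs_quarterTurn halt h₁)).trans
      (joinedIn_positivePairs_left h₂ h₃)).trans (joinedIn_positivePairs_right h₃ h')
  · exact (joinedIn_positivePairs_left h hgt).trans (joinedIn_positivePairs_right hgt h')

theorem isPathConnected_positivePairs {ω : V →ₗ[ℝ] V →ₗ[ℝ] ℝ} (halt : ω.IsAlt) (hω : ω ≠ 0) :
    IsPathConnected (positivePairs ω) := by
  refine isPathConnected_iff.2 ⟨positivePairs_nonempty hω, ?_⟩
  rintro ⟨a, b⟩ (h : 0 < ω a b) ⟨a', b'⟩ (h' : 0 < ω a' b')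
  by_cases h0 : ω a' b = 0
  · obtain ⟨s, hs, hs'⟩ : ∃ s : ℝ, 0 < s ∧ 0 < ω a (b + s • b') := by
      refine ⟨ω a b / (1 + |ω a b'|), by positivity, ?_⟩
      have hd : 0 < 1 + |ω a b'| := by positivity
      have := neg_abs_le (ω a b')
      have e : ω a (b + (ω a b / (1 + |ω a b'|)) • b') =
          ω a b * (1 + |ω a b'| + ω a b') / (1 + |ω a b'|) := by
        simp only [map_add, map_smul, smul_eq_mul]; field_simp
      rw [e]
      exact div_pos (mul_pos h (by linarith)) hd
    refine (joinedIn_positivePairs_right h hs').trans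
      (joinedIn_positivePairs_of_ne_zero halt hs' h' ?_)
    simpa [h0] using ⟨hs.ne', h'.ne'⟩
  · exact joinedIn_positivePairs_of_ne_zero halt h h' h0

end AlternatingForm

theorem isPreconnected_image_positivePairs_prod_univ {V W : Type*} [AddCommGroup V] [Module ℝ V]
    [TopologicalSpace V] [IsTopologicalAddGroup V] [ContinuousSMul ℝ V] [TopologicalSpace W]
    {ω : V →ₗ[ℝ] V →ₗ[ℝ] ℝ} (halt : ω.IsAlt) (hω : ω ≠ 0) {Φ : (V × V) × V → W}
    (hΦ : Continuous Φ) : IsPreconnected (Φ '' (positivePairs ω ×ˢ Set.univ)) :=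
  ((isPathConnected_positivePairs halt hω).isConnected.isPreconnected.prod
    isPreconnected_univ).image Φ hΦ.continuousOn

theorem convexHull_image_positivePairs_prod_univ {V W : Type*} [AddCommGroup V] [Module ℝ V]
    [AddCommGroup W] [Module ℝ W] {ω : V →ₗ[ℝ] V →ₗ[ℝ] ℝ} (hω : ω ≠ 0)
    (Φ : (V × V) × V →ᵃ[ℝ] W) :
    convexHull ℝ (Φ '' (positivePairs ω ×ˢ Set.univ)) = Set.range Φ := by
  rw [← Φ.image_convexHull, convexHull_prod, convexHull_positivePairs hω, convexHull_univ,
    Set.univ_prod_univ, Set.image_univ]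

theorem connectedComponentIn_eq_inter_pos {W : Type*} [TopologicalSpace W] {X : Set W} {f : W → ℝ}
    (hf : Continuous f) (hne : ∀ x ∈ X, f x ≠ 0) (hpre : IsPreconnected (X ∩ {x | 0 < f x}))
    {x : W} (hx : x ∈ X) (hfx : 0 < f x) : connectedComponentIn X x = X ∩ {x | 0 < f x} := by
  refine Set.Subset.antisymm (fun y hy => ⟨connectedComponentIn_subset X x hy, ?_⟩)
    (hpre.subset_connectedComponentIn ⟨hx, hfx⟩ Set.inter_subset_left)
  by_contra hfy
  obtain ⟨z, hz, hz0⟩ := isPreconnected_connectedComponentIn.intermediate_value hy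
    (mem_connectedComponentIn hx) hf.continuousOn ⟨not_lt.1 hfy, hfx.le⟩
  exact hne z (connectedComponentIn_subset X x hz) hz0

theorem det3_eq (a b c : V3) : det3 a b c =
    a 0 * (b 1 * c 2 - b 2 * c 1) - a 1 * (b 0 * c 2 - b 2 * c 0)
      + a 2 * (b 0 * c 1 - b 1 * c 0) := by
  simp [det3, Matrix.det_fin_three]
  ring

theorem det3_ne_zero_iff (a b c : V3) :
    det3 a b c ≠ 0 ↔ ∀ w : V3, ⟪w, a⟫ = 0 → ⟪w, b⟫ = 0 → ⟪w, c⟫ = 0 → w = 0 := by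
  rw [det3, ne_eq, ← Matrix.exists_vecMul_eq_zero_iff]
  constructor
  · intro h w ha hb hc
    by_contra hw
    refine h ⟨w.ofLp, fun h0 => hw (by ext i; simp [h0]), funext fun j => ?_⟩
    fin_cases j
    · simpa [Matrix.vecMul, dotProduct, PiLp.inner_apply, Fin.sum_univ_three, mul_comm] using ha
    · simpa [Matrix.vecMul, dotProduct, PiLp.inner_apply, Fin.sum_univ_three, mul_comm] using hb
    · simpa [Matrix.vecMul, dotProduct, PiLp.inner_apply, Fin.sum_univ_three, mul_comm] using hc
  · rintro h ⟨w, hw, h0⟩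
    have key : ∀ j, ∑ i, w i * (![a, b, c] j) i = 0 := fun j => congrFun h0 j
    refine hw (congrArg WithLp.ofLp (h (WithLp.toLp 2 w) ?_ ?_ ?_))
    · simpa [PiLp.inner_apply, mul_comm] using key 0
    · simpa [PiLp.inner_apply, mul_comm] using key 1
    · simpa [PiLp.inner_apply, mul_comm] using key 2

/-- The bilinear form `(a, b) ↦ det (t, a, b)`. -/
def detForm (t : V3) : V3 →ₗ[ℝ] V3 →ₗ[ℝ] ℝ :=
  LinearMap.mk₂ ℝ (det3 t)
    (fun _ _ _ => by simp only [det3_eq, PiLp.add_apply]; ring)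
    (fun _ _ _ => by simp only [det3_eq, PiLp.smul_apply, smul_eq_mul]; ring)
    (fun _ _ _ => by simp only [det3_eq, PiLp.add_apply]; ring)
    (fun _ _ _ => by simp only [det3_eq, PiLp.smul_apply, smul_eq_mul]; ring)

theorem detForm_isAlt (t : V3) : (detForm t).IsAlt := fun x => by
  simp only [detForm, LinearMap.mk₂_apply, det3_eq]
  ring

theorem continuous_det3 {X : Type*} [TopologicalSpace X] {a b c : X → V3} (ha : Continuous a)
    (hb : Continuous b) (hc : Continuous c) : Continuous fun x => det3 (a x) (b x) (c x) := by
  simp only [det3_eq]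
  fun_prop

theorem mem_RSet_iff_det3_ne_zero {S : V3 →ₗ[ℝ] V3 →ₗ[ℝ] V3} (hS : ∀ u v : V3, S u v = -S v u)
    (b : Module.Basis (Fin 3) ℝ V3) (L : Hom3) :
    L ∈ RSet S ↔ det3 (TT S L (b 1) (b 2)) (TT S L (b 0) (b 1)) (TT S L (b 0) (b 2)) ≠ 0 := by
  rw [det3_ne_zero_iff]
  refine forall_congr' fun w => ⟨fun h h₁ h₂ h₃ => h ?_, fun h hw => h (hw _ _) (hw _ _) (hw _ _)⟩
  let B : V3 →ₗ[ℝ] V3 →ₗ[ℝ] ℝ := LinearMap.mk₂ ℝ (fun u v => ⟪w, TT S L u v⟫)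
    (fun _ _ _ => by
      simp only [TT, map_add, LinearMap.add_apply, add_apply, inner_add_right,
        inner_sub_right]; ring)
    (fun _ _ _ => by
      simp only [TT, map_smul, LinearMap.smul_apply, smul_apply,
        inner_add_right, inner_sub_right, inner_smul_right, smul_eq_mul]; ring)
    (fun _ _ _ => by
      simp only [TT, map_add, add_apply, inner_add_right,
        inner_sub_right]; ring)
    (fun _ _ _ => by
      simp only [TT, map_smul, smul_apply,
        inner_add_right, inner_sub_right, inner_smul_right, smul_eq_mul]; ring)
  have hskew : ∀ u v, TT S L u v = -TT S L v u := fun u v => by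
    simp only [TT, hS u v]; abel
  have hself : ∀ u, ⟪w, TT S L u u⟫ = 0 := fun u => by
    have := congrArg (inner ℝ w) (hskew u u)
    rw [inner_neg_right] at this
    linarith
  have hswap : ∀ u v, ⟪w, TT S L u v⟫ = 0 → ⟪w, TT S L v u⟫ = 0 := fun u v h => by
    rw [hskew v u, inner_neg_right, h, neg_zero]
  have hbasis : ∀ i j, ⟪w, TT S L (b i) (b j)⟫ = 0 := by
    simp only [Fin.forall_fin_succ, IsEmpty.forall_iff, and_true]
    exact ⟨⟨hself _, h₂, h₃⟩, ⟨hswap _ _ h₂, hself _, h₁⟩, hswap _ _ h₃, hswap _ _ h₁, hself _⟩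
  have hB : B = 0 := LinearMap.ext_basis b b hbasis
  exact fun u v => LinearMap.congr_fun₂ hB u v

/-- A basis of `ℝ³` whose last two vectors lie in a given plane. -/
theorem exists_basis_of_finrank_eq_two (E : Submodule ℝ V3) (hE : Module.finrank ℝ E = 2) :
    ∃ (b : Module.Basis (Fin 3) ℝ V3) (c : Module.Basis (Fin 2) ℝ E),
      b 1 = c 0 ∧ b 2 = c 1 := by
  let c := Module.finBasisOfFinrankEq ℝ E hE
  have hspan : Submodule.span ℝ (Set.range fun i => (c i : V3)) = E := by
    have := congrArg (Submodule.map E.subtype) c.span_eq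
    rwa [Submodule.map_span, ← Set.range_comp, Submodule.map_top, Submodule.range_subtype] at this
  obtain ⟨n, -, hn⟩ : ∃ n ∈ (⊤ : Submodule ℝ V3), n ∉ E := by
    refine SetLike.exists_of_lt (lt_top_iff_ne_top.2 ?_)
    rintro rfl
    simp at hE
  have hli : LinearIndependent ℝ (Fin.cons n fun i => (c i : V3) : Fin 3 → V3) :=
    (c.linearIndependent.map' E.subtype E.ker_subtype).finCons (by
      change n ∉ Submodule.span ℝ (Set.range fun i => (c i : V3))
      rwa [hspan])
  refine ⟨basisOfLinearIndependentOfCardEqFinrank hli (by simp), c, ?_, ?_⟩ <;>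
    rw [coe_basisOfLinearIndependentOfCardEqFinrank] <;> rfl

/-- The endomorphism-valued map vanishing on `b 1`, `b 2` and sending `b 0` to the endomorphism
with values `p.2`, `p.1.1`, `p.1.2` on `b 0`, `b 1`, `b 2`. -/
noncomputable def transverseMap (b : Module.Basis (Fin 3) ℝ V3) : (V3 × V3) × V3 →ₗ[ℝ] Hom3 where
  toFun p := (LinearMap.toContinuousLinearMap (b.coord 0)).smulRight
    ((LinearMap.toContinuousLinearMap (b.coord 1)).smulRight p.1.1 +
      (LinearMap.toContinuousLinearMap (b.coord 2)).smulRight p.1.2 +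
      (LinearMap.toContinuousLinearMap (b.coord 0)).smulRight p.2)
  map_add' p q := by
    refine ContinuousLinearMap.ext fun u => ContinuousLinearMap.ext fun v => ?_
    simp only [ContinuousLinearMap.smulRight_apply, add_apply,
      smul_apply, Prod.fst_add, Prod.snd_add]
    module
  map_smul' r p := by
    refine ContinuousLinearMap.ext fun u => ContinuousLinearMap.ext fun v => ?_
    simp only [ContinuousLinearMap.smulRight_apply, add_apply,
      smul_apply, Prod.smul_fst, Prod.smul_snd, RingHom.id_apply]
    module

theorem transverseMap_apply (b : Module.Basis (Fin 3) ℝ V3) (p : (V3 × V3) × V3) (u v : V3) :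
    transverseMap b p u v = b.repr u 0 •
      (b.repr v 1 • p.1.1 + b.repr v 2 • p.1.2 + b.repr v 0 • p.2) := rfl

/-- An affine parametrization of `LSet E Λ` in which the values of `TT S L` on the basis pairs
transverse to `E` are free parameters. -/
theorem exists_affine_parametrization (S : V3 →ₗ[ℝ] V3 →ₗ[ℝ] V3) {E : Submodule ℝ V3}
    {Λ : E →ₗ[ℝ] End3} {b : Module.Basis (Fin 3) ℝ V3} {c : Module.Basis (Fin 2) ℝ E}
    (h₁ : b 1 = c 0) (h₂ : b 2 = c 1) {L₀ : Hom3} (hL₀ : L₀ ∈ LSet E Λ) :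
    ∃ Φ : (V3 × V3) × V3 →ᵃ[ℝ] Hom3, Continuous Φ ∧ Set.range Φ = LSet E Λ ∧
      ∀ p, TT S (Φ p) (b 1) (b 2) = TT S L₀ (b 1) (b 2) ∧
        TT S (Φ p) (b 0) (b 1) = p.1.1 ∧ TT S (Φ p) (b 0) (b 2) = p.1.2 := by
  let q : (V3 × V3) × V3 := ((TT S L₀ (b 0) (b 1), TT S L₀ (b 0) (b 2)), 0)
  let Φ : (V3 × V3) × V3 →ᵃ[ℝ] Hom3 :=
    (transverseMap b).toAffineMap + AffineMap.const ℝ _ (L₀ - transverseMap b q)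
  have hΦ : ∀ p, Φ p = L₀ + transverseMap b (p - q) := fun p => by
    rw [map_sub]
    exact add_sub_left_comm (α := Hom3) _ _ _
  have hLSet : ∀ L : Hom3, L ∈ LSet E Λ ↔ L (b 1) = L₀ (b 1) ∧ L (b 2) = L₀ (b 2) := by
    intro L
    constructor
    · intro hL
      rw [h₁, h₂]
      exact ⟨(hL _).trans (hL₀ _).symm, (hL _).trans (hL₀ _).symm⟩
    · rintro ⟨hL₁, hL₂⟩
      have : L.toLinearMap ∘ₗ E.subtype = Λ := c.ext fun i => by
        rw [← hL₀ (c i)]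
        fin_cases i
        · simpa [h₁] using hL₁
        · simpa [h₂] using hL₂
      exact fun x => LinearMap.congr_fun this x
  refine ⟨Φ, ?_, ?_, fun p => ?_⟩
  · have hc : Continuous (transverseMap b) :=
      LinearMap.continuous_of_finiteDimensional (E := (V3 × V3) × V3) (F' := Hom3) _
    have : ContinuousAdd Hom3 :=
      (ContinuousLinearMap.topologicalAddGroup (E := V3) (F := End3)).toContinuousAdd
    exact hc.add continuous_const
  · ext L
    rw [hLSet]
    constructor
    · rintro ⟨p, rfl⟩
      constructor <;> ext1 v <;> simp [hΦ, transverseMap_apply]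
    · rintro ⟨hL₁, hL₂⟩
      refine ⟨(((L - L₀) (b 0) (b 1), (L - L₀) (b 0) (b 2)), (L - L₀) (b 0) (b 0)) + q, ?_⟩
      rw [hΦ, add_sub_cancel_right]
      refine ((sub_eq_iff_eq_add' (G := Hom3)).1 ?_).symm
      refine ContinuousLinearMap.coe_injective (b.ext fun i => ?_)
      refine ContinuousLinearMap.coe_injective (b.ext fun j => ?_)
      change (L - L₀) (b i) (b j) = transverseMap b _ (b i) (b j)
      fin_cases i
      · fin_cases j <;> simp [transverseMap_apply]
      · simp [transverseMap_apply, hL₁]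
      · simp [transverseMap_apply, hL₂]
  · refine ⟨?_, ?_, ?_⟩ <;> simp [hΦ, TT, transverseMap_apply, q] <;> abel

/-- Gromov's ampleness lemma: if the set of maps in `ℒ` satisfying the nondegeneracy
condition `R` is nonempty, then it has exactly two connected components, and the convex
hull of each connected component equals `ℒ`. -/
theorem ample_relation_two_components_convex_hull
    (S : V3 →ₗ[ℝ] V3 →ₗ[ℝ] V3) (hS : ∀ u v : V3, S u v = - S v u)
    (E : Submodule ℝ V3) (hE : Module.finrank ℝ E = 2)
    (Λ : E →ₗ[ℝ] End3)
    (hne : (LSet E Λ ∩ RSet S).Nonempty) :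
    (∃ L₁ ∈ LSet E Λ ∩ RSet S, ∃ L₂ ∈ LSet E Λ ∩ RSet S,
      connectedComponentIn (LSet E Λ ∩ RSet S) L₁ ≠
        connectedComponentIn (LSet E Λ ∩ RSet S) L₂ ∧
      ∀ L ∈ LSet E Λ ∩ RSet S,
        connectedComponentIn (LSet E Λ ∩ RSet S) L =
            connectedComponentIn (LSet E Λ ∩ RSet S) L₁ ∨
          connectedComponentIn (LSet E Λ ∩ RSet S) L =
            connectedComponentIn (LSet E Λ ∩ RSet S) L₂) ∧
    (∀ L ∈ LSet E Λ ∩ RSet S,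
      convexHull ℝ (connectedComponentIn (LSet E Λ ∩ RSet S) L) = LSet E Λ) := by
  obtain ⟨b, c, h₁, h₂⟩ := exists_basis_of_finrank_eq_two E hE
  obtain ⟨L₀, hL₀, hR₀⟩ := hne
  obtain ⟨Φ, hΦc, hΦr, hΦT⟩ := exists_affine_parametrization S h₁ h₂ hL₀
  set X := LSet E Λ ∩ RSet S
  set ω := detForm (TT S L₀ (b 1) (b 2))
  let f : Hom3 → ℝ := fun L =>
    det3 (TT S L (b 1) (b 2)) (TT S L (b 0) (b 1)) (TT S L (b 0) (b 2))
  have hf : Continuous f := by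
    refine continuous_det3 ?_ ?_ ?_ <;> simp only [TT] <;> fun_prop
  have hX : ∀ L, L ∈ X ↔ L ∈ LSet E Λ ∧ f L ≠ 0 := fun L =>
    and_congr_right fun _ => mem_RSet_iff_det3_ne_zero hS b L
  have hfΦ : ∀ p, f (Φ p) = ω p.1.1 p.1.2 := fun p => by
    obtain ⟨hp₁, hp₂, hp₃⟩ := hΦT p
    simp only [f, hp₁, hp₂, hp₃]
    rfl
  have halt : ω.IsAlt := detForm_isAlt _
  have hω : ω ≠ 0 := fun h0 => (mem_RSet_iff_det3_ne_zero hS b L₀).1 hR₀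
    (LinearMap.congr_fun₂ h0 _ _)
  have halt' : (-ω).IsAlt := fun x => by simp [halt.self_eq_zero]
  have hω' : -ω ≠ 0 := fun h0 => hω (LinearMap.ext₂ fun x y => by
    simpa using LinearMap.congr_fun₂ h0 x y)
  have hpos : X ∩ {L | 0 < f L} = Φ '' (positivePairs ω ×ˢ Set.univ) := by
    ext L
    constructor
    · rintro ⟨⟨hL, -⟩, hfL⟩
      obtain ⟨p, rfl⟩ := hΦr.symm ▸ hL
      exact ⟨p, ⟨(hfΦ p).subst (motive := (0 < ·)) hfL, trivial⟩, rfl⟩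
    · rintro ⟨p, ⟨hp, -⟩, rfl⟩
      have hp' : 0 < f (Φ p) := (hfΦ p).symm ▸ hp
      exact ⟨(hX _).2 ⟨hΦr ▸ ⟨p, rfl⟩, hp'.ne'⟩, hp'⟩
  have hneg : X ∩ {L | 0 < -f L} = Φ '' (positivePairs (-ω) ×ˢ Set.univ) := by
    ext L
    constructor
    · rintro ⟨⟨hL, -⟩, hfL⟩
      obtain ⟨p, rfl⟩ := hΦr.symm ▸ hL
      exact ⟨p, ⟨(hfΦ p).subst (motive := (0 < -·)) hfL, trivial⟩, rfl⟩
    · rintro ⟨p, ⟨hp, -⟩, rfl⟩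
      have hp' : 0 < -f (Φ p) := (hfΦ p).symm ▸ hp
      exact ⟨(hX _).2 ⟨hΦr ▸ ⟨p, rfl⟩, (neg_pos.1 hp').ne⟩, hp'⟩
  have hcpos : ∀ L ∈ X, 0 < f L → connectedComponentIn X L = X ∩ {L | 0 < f L} :=
    fun L hL => connectedComponentIn_eq_inter_pos hf (fun L hL => ((hX L).1 hL).2)
      (hpos ▸ isPreconnected_image_positivePairs_prod_univ halt hω hΦc) hL
  have hcneg : ∀ L ∈ X, f L < 0 → connectedComponentIn X L = X ∩ {L | 0 < -f L} :=
    fun L hL hfL => connectedComponentIn_eq_inter_pos hf.neg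
      (fun L hL => neg_ne_zero.2 ((hX L).1 hL).2)
      (hneg ▸ isPreconnected_image_positivePairs_prod_univ halt' hω' hΦc) hL (neg_pos.2 hfL)
  obtain ⟨L₁, hL₁, hfL₁⟩ : (X ∩ {L | 0 < f L}).Nonempty :=
    hpos ▸ ((positivePairs_nonempty hω).prod Set.univ_nonempty).image Φ
  obtain ⟨L₂, hL₂, hfL₂⟩ : (X ∩ {L | 0 < -f L}).Nonempty :=
    hneg ▸ ((positivePairs_nonempty hω').prod Set.univ_nonempty).image Φ
  replace hfL₂ : f L₂ < 0 := neg_pos.1 hfL₂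
  refine ⟨⟨L₁, hL₁, L₂, hL₂, fun h => ?_, fun L hL => ?_⟩, fun L hL => ?_⟩
  · have : L₂ ∈ X ∩ {L | 0 < f L} := hcpos L₁ hL₁ hfL₁ ▸ h ▸ mem_connectedComponentIn hL₂
    exact lt_asymm hfL₂ this.2
  · rcases ((hX L).1 hL).2.lt_or_gt with h | h
    · exact Or.inr ((hcneg L hL h).trans (hcneg L₂ hL₂ hfL₂).symm)
    · exact Or.inl ((hcpos L hL h).trans (hcpos L₁ hL₁ hfL₁).symm)
  · rcases ((hX L).1 hL).2.lt_or_gt with h | h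
    · rw [hcneg L hL h, hneg]
      exact (convexHull_image_positivePairs_prod_univ hω' Φ).trans hΦr
    · rw [hcpos L hL h, hpos]
      exact (convexHull_image_positivePairs_prod_univ hω Φ).trans hΦr
end

section
/- Let S : ℝ³ × ℝ³ → ℝ³ be a skew-symmetric bilinear map, let E = span{e₂, e₃} ⊆ ℝ³, let λ : E → End(ℝ³) be a linear map, and let ℒ be the set of linear maps L : ℝ³ → End(ℝ³) whose restriction to E equals λ. Then ℒ ∩ R is nonempty if and only if S(e₂,e₃) + λ(e₂)e₃ − λ(e₃)e₂ ≠ 0. -/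
open scoped RealInnerProductSpace

/-- Every vector of `ℝ³` is expanded in the standard basis. -/
lemma eq_sum_basis (u : V3) : u = u 0 • e1 + u 1 • e2 + u 2 • e3 := by
  ext i
  fin_cases i <;> simp [e1, e2, e3]

/-- `T_L` is determined by its values on pairs of distinct standard basis vectors. -/
lemma TT_eq_sum (S : V3 →ₗ[ℝ] V3 →ₗ[ℝ] V3) (hS : ∀ u v : V3, S u v = - S v u)
    (L : Hom3) (u v : V3) :
    TT S L u v = (u 0 * v 1 - u 1 * v 0) • TT S L e1 e2
      + (u 0 * v 2 - u 2 * v 0) • TT S L e1 e3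
      + (u 1 * v 2 - u 2 * v 1) • TT S L e2 e3 := by
  have hself (x : V3) : S x x = 0 := by
    simpa [eq_neg_iff_add_eq_zero, ← two_smul ℝ] using hS x x
  conv_lhs => rw [eq_sum_basis u, eq_sum_basis v]
  simp only [TT, map_add, map_smul, LinearMap.add_apply, LinearMap.smul_apply,
    add_apply, smul_apply, hself, hS e2 e1, hS e3 e1, hS e3 e2]
  module

/-- Two vectors of `ℝ³` have a nonzero common orthogonal vector. -/
lemma exists_ne_zero_inner_eq_zero (a b : V3) :
    ∃ w : V3, w ≠ 0 ∧ ⟪w, a⟫ = 0 ∧ ⟪w, b⟫ = 0 := by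
  classical
  have hne : (Submodule.span ℝ {a, b})ᗮ ≠ ⊥ := by
    intro h
    rw [Submodule.orthogonal_eq_bot_iff] at h
    have hle := finrank_span_finset_le_card (R := ℝ) ({a, b} : Finset V3)
    rw [Finset.coe_pair, Set.finrank, h, finrank_top, finrank_euclideanSpace_fin] at hle
    have := hle.trans Finset.card_le_two
    omega
  obtain ⟨w, hw, hw0⟩ := Submodule.exists_mem_ne_zero_of_ne_bot hne
  rw [Submodule.mem_orthogonal'] at hw
  exact ⟨w, hw0, hw a (Submodule.subset_span (by simp)), hw b (Submodule.subset_span (by simp))⟩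

/-- A nonzero vector of `ℝ³` can be completed to a spanning triple. -/
lemma exists_pair_inner_separating {c : V3} (hc : c ≠ 0) :
    ∃ p q : V3, ∀ w : V3, ⟪w, p⟫ = 0 → ⟪w, q⟫ = 0 → ⟪w, c⟫ = 0 → w = 0 := by
  have hi : c 0 ≠ 0 ∨ c 1 ≠ 0 ∨ c 2 ≠ 0 := by
    by_contra! h
    exact hc (by ext i; fin_cases i <;> simp [h])
  have hext (w : V3) (h0 : w 0 = 0) (h1 : w 1 = 0) (h2 : w 2 = 0) : w = 0 := by
    ext i; fin_cases i <;> simp [h0, h1, h2]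
  rcases hi with h | h | h
  · refine ⟨e2, e3, fun w hp hq hr => ?_⟩
    simp [e2, e3, PiLp.inner_apply, Fin.sum_univ_three] at hp hq hr
    exact hext w (by simpa [hp, hq, h] using hr) hp hq
  · refine ⟨e1, e3, fun w hp hq hr => ?_⟩
    simp [e1, e3, PiLp.inner_apply, Fin.sum_univ_three] at hp hq hr
    exact hext w hp (by simpa [hp, hq, h] using hr) hq
  · refine ⟨e1, e2, fun w hp hq hr => ?_⟩
    simp [e1, e2, PiLp.inner_apply, Fin.sum_univ_three] at hp hq hr
    exact hext w hp hq (by simpa [hp, hq, h] using hr)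

/-- A linear map from `ℝ³` with prescribed values on the standard basis. -/
lemma exists_clm_basis {F : Type*} [NormedAddCommGroup F] [NormedSpace ℝ F] (a b c : F) :
    ∃ A : V3 →L[ℝ] F, A e1 = a ∧ A e2 = b ∧ A e3 = c := by
  let π (i : Fin 3) : V3 →L[ℝ] ℝ := EuclideanSpace.proj i
  refine ⟨(π 0).smulRight a + (π 1).smulRight b + (π 2).smulRight c, ?_, ?_, ?_⟩ <;>
    simp [π, e1, e2, e3]

/-- For `E = span{e₂,e₃}`, the set `ℒ ∩ R` is nonempty if and only if
`S(e₂,e₃) + λ(e₂)e₃ − λ(e₃)e₂ ≠ 0`. -/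
theorem LSet_inter_RSet_nonempty_iff
    (S : V3 →ₗ[ℝ] V3 →ₗ[ℝ] V3) (hS : ∀ u v : V3, S u v = - S v u)
    (E : Submodule ℝ V3) (hE : E = Submodule.span ℝ {e2, e3})
    (h2 : e2 ∈ E) (h3 : e3 ∈ E)
    (Λ : E →ₗ[ℝ] End3) :
    (LSet E Λ ∩ RSet S).Nonempty ↔
      S e2 e3 + Λ ⟨e2, h2⟩ e3 - Λ ⟨e3, h3⟩ e2 ≠ 0 := by
  constructor
  · rintro ⟨L, hL, hR⟩ h0
    have hT : TT S L e2 e3 = 0 := by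
      rw [TT, hL ⟨e2, h2⟩, hL ⟨e3, h3⟩, h0]
    obtain ⟨w, hw, ha, hb⟩ := exists_ne_zero_inner_eq_zero (TT S L e1 e2) (TT S L e1 e3)
    refine hw (hR w fun u v => ?_)
    rw [TT_eq_sum S hS]
    simp [inner_add_right, inner_smul_right, ha, hb, hT]
  · intro hc
    obtain ⟨p, q, hpq⟩ := exists_pair_inner_separating hc
    obtain ⟨A, -, hA2, hA3⟩ := exists_clm_basis 0
      (p - S e1 e2 + Λ ⟨e2, h2⟩ e1) (q - S e1 e3 + Λ ⟨e3, h3⟩ e1)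
    obtain ⟨L, hL1, hL2, hL3⟩ := exists_clm_basis A (Λ ⟨e2, h2⟩) (Λ ⟨e3, h3⟩)
    refine ⟨L, ?_, fun w hw => hpq w ?_ ?_ ?_⟩
    · rintro ⟨x, hx⟩
      obtain ⟨s, t, rfl⟩ := Submodule.mem_span_pair.mp (hE ▸ hx)
      have hsum : (⟨s • e2 + t • e3, hx⟩ : E) = s • ⟨e2, h2⟩ + t • ⟨e3, h3⟩ := rfl
      rw [hsum, map_add, map_smul, map_smul, ← hL2, ← hL3]
      simp
    · have hT : TT S L e1 e2 = p := by
        rw [TT, hL1, hL2, hA2]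
        abel
      exact hT ▸ hw e1 e2
    · have hT : TT S L e1 e3 = q := by
        rw [TT, hL1, hL3, hA3]
        abel
      exact hT ▸ hw e1 e3
    · simpa [TT, hL2, hL3] using hw e2 e3
end

section
/- Let S : ℝ³ × ℝ³ → ℝ³ be a skew-symmetric bilinear map, let E = span{e₂, e₃} ⊆ ℝ³, let λ : E → End(ℝ³) be a linear map with S(e₂,e₃) + λ(e₂)e₃ − λ(e₃)e₂ ≠ 0, and let ℒ be the set of linear maps L : ℝ³ → End(ℝ³) whose restriction to E equals λ. Then each of the two sets {L ∈ ℒ : det(T_L(e₂,e₃), T_L(e₃,e₁), T_L(e₁,e₂)) > 0} and {L ∈ ℒ : det(T_L(e₂,e₃), T_L(e₃,e₁), T_L(e₁,e₂)) < 0} is nonempty and path-connected, where det(a,b,c) denotes the determinant of the 3×3 matrix with columns a, b, c. -/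
open scoped RealInnerProductSpace

theorem exists_det3_pos {a : V3} (ha : a ≠ 0) : ∃ b c : V3, 0 < det3 a b c := by
  have hcoord : ∃ i, a i ≠ 0 := by
    by_contra! h
    exact ha (by ext i; simpa using h i)
  obtain ⟨i, hi⟩ := hcoord
  have hpos : 0 < a i * a i := mul_self_pos.mpr hi
  fin_cases i
  · exact ⟨e2, a 0 • e3, by simpa [det3_eq, e2, e3] using hpos⟩
  · exact ⟨e3, a 1 • e1, by simpa [det3_eq, e3, e1] using hpos⟩
  · exact ⟨e1, a 2 • e2, by simpa [det3_eq, e1, e2] using hpos⟩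

/-- Moving only the last column inside `{det3 a b c > 0}`. -/
theorem joinedIn_det3_pos_right {a b c c' : V3} (h : 0 < det3 a b c) (h' : 0 < det3 a b c') :
    JoinedIn {x : V3 × V3 | 0 < det3 a x.1 x.2} (b, c) (b, c') := by
  refine JoinedIn.of_segment_subset ?_
  rintro _ ⟨s, t, hs, ht, hst, rfl⟩
  have key : det3 a (s • b + t • b) (s • c + t • c') =
      (s + t) * (s * det3 a b c + t * det3 a b c') := by
    simp only [det3_eq, PiLp.add_apply, PiLp.smul_apply, smul_eq_mul]
    ring
  simp only [Set.mem_ofPred_eq, Prod.smul_mk, Prod.mk_add_mk, key, hst, one_mul]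
  rcases hs.eq_or_lt with rfl | hs
  · have : t = 1 := by linarith
    simpa [this] using h'
  · have := mul_nonneg ht h'.le
    have := mul_pos hs h
    linarith

/-- Moving only the middle column inside `{det3 a b c > 0}`. -/
theorem joinedIn_det3_pos_left {a b b' c : V3} (h : 0 < det3 a b c) (h' : 0 < det3 a b' c) :
    JoinedIn {x : V3 × V3 | 0 < det3 a x.1 x.2} (b, c) (b', c) := by
  refine JoinedIn.of_segment_subset ?_
  rintro _ ⟨s, t, hs, ht, hst, rfl⟩
  have key : det3 a (s • b + t • b') (s • c + t • c) =
      (s + t) * (s * det3 a b c + t * det3 a b' c) := by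
    simp only [det3_eq, PiLp.add_apply, PiLp.smul_apply, smul_eq_mul]
    ring
  simp only [Set.mem_ofPred_eq, Prod.smul_mk, Prod.mk_add_mk, key, hst, one_mul]
  rcases hs.eq_or_lt with rfl | hs
  · have : t = 1 := by linarith
    simpa [this] using h'
  · have := mul_nonneg ht h'.le
    have := mul_pos hs h
    linarith

theorem joinedIn_det3_pos_of_ne {a b c b' c' : V3} (h : 0 < det3 a b c) (h' : 0 < det3 a b' c')
    (hne : det3 a b' b ≠ 0) :
    JoinedIn {x : V3 × V3 | 0 < det3 a x.1 x.2} (b, c) (b', c') := by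
  let r : ℝ := (1 - det3 a b' c) / det3 a b' b
  have h1 : det3 a b (c + r • b) = det3 a b c := by
    simp only [det3_eq, PiLp.add_apply, PiLp.smul_apply, smul_eq_mul]
    ring
  have h2 : det3 a b' (c + r • b) = det3 a b' c + r * det3 a b' b := by
    simp only [det3_eq, PiLp.add_apply, PiLp.smul_apply, smul_eq_mul]
    ring
  have h3 : r * det3 a b' b = 1 - det3 a b' c := div_mul_cancel₀ _ hne
  have h1' : 0 < det3 a b (c + r • b) := h1 ▸ h
  have h2' : 0 < det3 a b' (c + r • b) := by rw [h2, h3]; norm_num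
  exact ((joinedIn_det3_pos_right h h1').trans (joinedIn_det3_pos_left h1' h2')).trans
    (joinedIn_det3_pos_right h2' h')

theorem isPathConnected_det3_pos {a : V3} (ha : a ≠ 0) :
    IsPathConnected {x : V3 × V3 | 0 < det3 a x.1 x.2} := by
  rw [isPathConnected_iff]
  constructor
  · obtain ⟨b, c, h⟩ := exists_det3_pos ha
    exact ⟨(b, c), h⟩
  rintro ⟨b, c⟩ h ⟨b', c'⟩ h'
  simp only [Set.mem_ofPred_eq] at h h'
  by_cases hne : det3 a b' b = 0
  · have plucker : det3 a b c * det3 a b' c' =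
        det3 a b' c * det3 a b c' - det3 a b' b * det3 a c c' := by
      simp only [det3_eq]
      ring
    have hc : det3 a b' c ≠ 0 := by
      intro h0
      rw [hne, h0] at plucker
      have := mul_pos h h'
      linarith
    have h1 : det3 a (b + c) c = det3 a b c := by
      simp only [det3_eq, PiLp.add_apply]
      ring
    have h2 : det3 a b' (b + c) = det3 a b' b + det3 a b' c := by
      simp only [det3_eq, PiLp.add_apply]
      ring
    have h1' : 0 < det3 a (b + c) c := h1 ▸ h
    exact (joinedIn_det3_pos_left h h1').trans
      (joinedIn_det3_pos_of_ne h1' h' (by rwa [h2, hne, zero_add]))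
  · exact joinedIn_det3_pos_of_ne h h' hne

theorem V3.eq_sum (x : V3) : x = x 0 • e1 + x 1 • e2 + x 2 • e3 := by
  ext i
  fin_cases i <;> simp [e1, e2, e3]

/-- The linear map `ℝ³ → W` sending the standard basis vectors to `u`, `v`, `w`. -/
noncomputable def ofBasisValues {W : Type*} [NormedAddCommGroup W] [NormedSpace ℝ W] (u v w : W) :
    V3 →L[ℝ] W :=
  (EuclideanSpace.proj (𝕜 := ℝ) (0 : Fin 3)).smulRight u +
    (EuclideanSpace.proj (𝕜 := ℝ) (1 : Fin 3)).smulRight v +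
    (EuclideanSpace.proj (𝕜 := ℝ) (2 : Fin 3)).smulRight w

section ofBasisValues

variable {W : Type*} [NormedAddCommGroup W] [NormedSpace ℝ W]

theorem ofBasisValues_apply (u v w : W) (x : V3) :
    ofBasisValues u v w x = x 0 • u + x 1 • v + x 2 • w := by
  simp [ofBasisValues]

@[simp] theorem ofBasisValues_e1 (u v w : W) : ofBasisValues u v w e1 = u := by
  simp [ofBasisValues_apply, e1]

@[simp] theorem ofBasisValues_e2 (u v w : W) : ofBasisValues u v w e2 = v := by
  simp [ofBasisValues_apply, e2]

@[simp] theorem ofBasisValues_e3 (u v w : W) : ofBasisValues u v w e3 = w := by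
  simp [ofBasisValues_apply, e3]

theorem ofBasisValues_self (L : V3 →L[ℝ] W) : ofBasisValues (L e1) (L e2) (L e3) = L := by
  ext1 x
  conv_rhs => rw [V3.eq_sum x]
  simp [ofBasisValues_apply]

theorem Continuous.ofBasisValues {X : Type*} [TopologicalSpace X] {u v w : X → W}
    (hu : Continuous u) (hv : Continuous v) (hw : Continuous w) :
    Continuous fun x => ofBasisValues (u x) (v x) (w x) := by
  have key (f : V3 →L[ℝ] ℝ) {g : X → W} (hg : Continuous g) :
      Continuous fun x => f.smulRight (g x) :=
    (ContinuousLinearMap.smulRightL ℝ V3 W f).continuous.comp hg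
  exact ((key _ hu).add (key _ hv)).add (key _ hw)

end ofBasisValues

theorem mem_LSet_span_iff {Λ : Submodule.span ℝ {e2, e3} →ₗ[ℝ] End3}
    (h2 : e2 ∈ Submodule.span ℝ {e2, e3}) (h3 : e3 ∈ Submodule.span ℝ {e2, e3}) {L : Hom3} :
    L ∈ LSet (Submodule.span ℝ {e2, e3}) Λ ↔ L e2 = Λ ⟨e2, h2⟩ ∧ L e3 = Λ ⟨e3, h3⟩ := by
  refine ⟨fun h => ⟨h ⟨e2, h2⟩, h ⟨e3, h3⟩⟩, ?_⟩
  rintro ⟨hL2, hL3⟩ ⟨x, hx⟩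
  obtain ⟨s, t, rfl⟩ := Submodule.mem_span_pair.mp hx
  have : (⟨s • e2 + t • e3, hx⟩ : Submodule.span ℝ {e2, e3}) =
      s • ⟨e2, h2⟩ + t • ⟨e3, h3⟩ := rfl
  rw [this, map_add, map_smul, map_smul, ← hL2, ← hL3]
  simp

theorem isPathConnected_LSet_det3_pos (S : V3 →ₗ[ℝ] V3 →ₗ[ℝ] V3)
    (Λ : Submodule.span ℝ {e2, e3} →ₗ[ℝ] End3) {a : V3} (ha : a ≠ 0) :
    IsPathConnected {L ∈ LSet (Submodule.span ℝ {e2, e3}) Λ |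
      0 < det3 a (TT S L e3 e1) (TT S L e1 e2)} := by
  have h2 : e2 ∈ Submodule.span ℝ {e2, e3} := Submodule.subset_span (by simp)
  have h3 : e3 ∈ Submodule.span ℝ {e2, e3} := Submodule.subset_span (by simp)
  let Φ : V3 × (V3 × V3) → Hom3 := fun x =>
    ofBasisValues
      (ofBasisValues x.1 (x.2.2 - S e1 e2 + Λ ⟨e2, h2⟩ e1) (S e3 e1 + Λ ⟨e3, h3⟩ e1 - x.2.1))
      (Λ ⟨e2, h2⟩) (Λ ⟨e3, h3⟩)
  have hΦ : Continuous Φ :=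
    Continuous.ofBasisValues
      (Continuous.ofBasisValues (by fun_prop) (by fun_prop) (by fun_prop))
      continuous_const continuous_const
  have h31 (x) : TT S (Φ x) e3 e1 = x.2.1 := by simp [TT, Φ]
  have h12 (x) : TT S (Φ x) e1 e2 = x.2.2 := by
    simp only [TT, Φ, ofBasisValues_e1, ofBasisValues_e2]
    abel
  have hconn := ((isPathConnected_univ (X := V3)).prod (isPathConnected_det3_pos ha)).image hΦ
  convert hconn using 1
  ext L
  simp only [Set.mem_ofPred_eq, mem_LSet_span_iff h2 h3, Set.mem_image]
  constructor
  · rintro ⟨⟨hL2, hL3⟩, hpos⟩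
    refine ⟨(L e1 e1, TT S L e3 e1, TT S L e1 e2), ⟨trivial, hpos⟩, ?_⟩
    have hA : ofBasisValues (L e1 e1) (TT S L e1 e2 - S e1 e2 + L e2 e1)
        (S e3 e1 + L e3 e1 - TT S L e3 e1) = L e1 := by
      conv_rhs => rw [← ofBasisValues_self (L e1)]
      congr 1 <;> simp only [TT] <;> abel
    simp only [Φ, ← hL2, ← hL3, hA, ofBasisValues_self]
  · rintro ⟨x, ⟨-, hx⟩, rfl⟩
    refine ⟨by simp [Φ], ?_⟩
    rw [h31, h12]
    exact hx

/-- For `E = span{e₂,e₃}` and `λ` with `S(e₂,e₃) + λ(e₂)e₃ − λ(e₃)e₂ ≠ 0`, the subsets of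
`ℒ` on which the determinant `det(T_L(e₂,e₃), T_L(e₃,e₁), T_L(e₁,e₂))` is positive,
respectively negative, are both nonempty and path-connected. -/
theorem LSet_pos_neg_det_pathConnected
    (S : V3 →ₗ[ℝ] V3 →ₗ[ℝ] V3) (hS : ∀ u v : V3, S u v = - S v u)
    (E : Submodule ℝ V3) (hE : E = Submodule.span ℝ {e2, e3})
    (h2 : e2 ∈ E) (h3 : e3 ∈ E)
    (Λ : E →ₗ[ℝ] End3)
    (hΛ : S e2 e3 + Λ ⟨e2, h2⟩ e3 - Λ ⟨e3, h3⟩ e2 ≠ 0) :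
    IsPathConnected
        {L ∈ LSet E Λ | 0 < det3 (TT S L e2 e3) (TT S L e3 e1) (TT S L e1 e2)} ∧
      IsPathConnected
        {L ∈ LSet E Λ | det3 (TT S L e2 e3) (TT S L e3 e1) (TT S L e1 e2) < 0} := by
  subst hE
  have hT {L : Hom3} (hL : L ∈ LSet (Submodule.span ℝ {e2, e3}) Λ) :
      TT S L e2 e3 = S e2 e3 + Λ ⟨e2, h2⟩ e3 - Λ ⟨e3, h3⟩ e2 := by
    obtain ⟨hL2, hL3⟩ := (mem_LSet_span_iff h2 h3).mp hL
    rw [TT, hL2, hL3]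
  constructor
  · convert isPathConnected_LSet_det3_pos S Λ hΛ using 1
    ext L
    exact and_congr_right fun hL => by rw [hT hL]
  · convert isPathConnected_LSet_det3_pos S Λ (neg_ne_zero.mpr hΛ) using 1
    ext L
    refine and_congr_right fun hL => ?_
    rw [hT hL, ← neg_pos]
    refine iff_of_eq (congrArg _ ?_)
    simp only [det3_eq, PiLp.neg_apply]
    ring
end

section
/- Let S : ℝ³ × ℝ³ → ℝ³ be a skew-symmetric bilinear map, let E = span{e₂, e₃} ⊆ ℝ³, let λ : E → End(ℝ³) be a linear map with S(e₂,e₃) + λ(e₂)e₃ − λ(e₃)e₂ ≠ 0, and let ℒ be the set of linear maps L : ℝ³ → End(ℝ³) whose restriction to E equals λ. Then every L ∈ ℒ is the midpoint L = ½(L' + L'') of two elements L', L'' of {L ∈ ℒ : det(T_L(e₂,e₃), T_L(e₃,e₁), T_L(e₁,e₂)) > 0}, and likewise the midpoint of two elements of {L ∈ ℒ : det(T_L(e₂,e₃), T_L(e₃,e₁), T_L(e₁,e₂)) < 0}; consequently the convex hull of each of these two sets equals ℒ. -/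
open scoped RealInnerProductSpace

theorem exists_det3_eq {a : V3} (ha : a ≠ 0) (r : ℝ) : ∃ p q : V3, det3 a p q = r := by
  obtain ⟨i, hi⟩ : ∃ i, a i ≠ 0 := by
    by_contra! h
    exact ha (by ext i; simpa using h i)
  fin_cases i
  · refine ⟨!₂[0, 1, 0], !₂[0, 0, r / a 0], ?_⟩
    simp only [Fin.zero_eta] at hi
    simp [det3_eq, mul_div_cancel₀ _ hi]
  · refine ⟨!₂[0, 0, 1], !₂[r / a 1, 0, 0], ?_⟩
    simp only [Fin.mk_one] at hi
    simp [det3_eq, mul_div_cancel₀ _ hi]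
  · refine ⟨!₂[1, 0, 0], !₂[0, r / a 2, 0], ?_⟩
    simp only [Fin.reduceFinMk] at hi
    simp [det3_eq, mul_div_cancel₀ _ hi]

theorem det3_add_smul (a b c p q : V3) (t : ℝ) :
    det3 a (b + t • p) (c + t • q) =
      det3 a b c + t * (det3 a b q + det3 a p c) + t ^ 2 * det3 a p q := by
  simp only [det3_eq, PiLp.add_apply, PiLp.smul_apply, smul_eq_mul]
  ring

/-- The element of `Hom(ℝ³, End(ℝ³))` vanishing on `e₂` and `e₃` whose value at `e₁` sends
`e₁, e₂, e₃` to `0, q, -p`. -/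
noncomputable def transverseHom (p q : V3) : Hom3 :=
  (EuclideanSpace.proj (0 : Fin 3) : V3 →L[ℝ] ℝ).smulRight
    ((EuclideanSpace.proj (1 : Fin 3) : V3 →L[ℝ] ℝ).smulRight q -
      (EuclideanSpace.proj (2 : Fin 3) : V3 →L[ℝ] ℝ).smulRight p)

theorem transverseHom_apply (p q u v : V3) :
    transverseHom p q u v = u 0 • (v 1 • q - v 2 • p) := by
  simp [transverseHom]

theorem transverseHom_eq_zero (p q : V3) {x : V3} (hx : x ∈ Submodule.span ℝ {e2, e3}) :
    transverseHom p q x = 0 := by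
  obtain ⟨a, b, rfl⟩ := Submodule.mem_span_pair.1 hx
  ext v : 1
  simp [transverseHom_apply, e2, e3]

theorem det3_TT_add_smul_transverseHom (S : V3 →ₗ[ℝ] V3 →ₗ[ℝ] V3) (L : Hom3) (p q : V3) (t : ℝ) :
    det3 (TT S (L + t • transverseHom p q) e2 e3) (TT S (L + t • transverseHom p q) e3 e1)
        (TT S (L + t • transverseHom p q) e1 e2) =
      det3 (TT S L e2 e3) (TT S L e3 e1 + t • p) (TT S L e1 e2 + t • q) := by
  congr 1
  · simp [TT, transverseHom_apply, e2, e3]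
  · simp [TT, transverseHom_apply, e1, e3]
    abel
  · simp [TT, transverseHom_apply, e1, e2]
    abel

theorem exists_quadratic_pos_pos_neg (d k : ℝ) :
    ∃ t : ℝ, 0 < d + t * k + t ^ 2 ∧ 0 < d + -t * k + (-t) ^ 2 := by
  refine ⟨1 + |d| + |k|, ?_, ?_⟩ <;>
    cases abs_cases d <;> cases abs_cases k <;> nlinarith

theorem exists_midpoint_det3_pos (S : V3 →ₗ[ℝ] V3 →ₗ[ℝ] V3)
    (Λ : Submodule.span ℝ {e2, e3} →ₗ[ℝ] End3)
    {L : Hom3} (hL : L ∈ LSet _ Λ) (hT : TT S L e2 e3 ≠ 0) {s : ℝ} (hs : s * s = 1) :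
    ∃ L' ∈ LSet _ Λ, ∃ L'' ∈ LSet _ Λ,
      0 < s * det3 (TT S L' e2 e3) (TT S L' e3 e1) (TT S L' e1 e2) ∧
      0 < s * det3 (TT S L'' e2 e3) (TT S L'' e3 e1) (TT S L'' e1 e2) ∧
      L = (2 : ℝ)⁻¹ • (L' + L'') := by
  obtain ⟨p, q, hpq⟩ := exists_det3_eq hT s
  have hmem (t : ℝ) : L + t • transverseHom p q ∈ LSet _ Λ := fun x ↦ by
    change L x + t • transverseHom p q x = Λ x
    rw [transverseHom_eq_zero p q x.2, hL x]
    ext v : 1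
    change Λ x v + t • (0 : V3) = Λ x v
    rw [smul_zero, add_zero]
  have hdet (t : ℝ) := det3_TT_add_smul_transverseHom S L p q t
  simp only [det3_add_smul, hpq] at hdet
  obtain ⟨t, ht, ht'⟩ := exists_quadratic_pos_pos_neg
    (s * det3 (TT S L e2 e3) (TT S L e3 e1) (TT S L e1 e2))
    (s * (det3 (TT S L e2 e3) (TT S L e3 e1) q + det3 (TT S L e2 e3) p (TT S L e1 e2)))
  refine ⟨_, hmem t, _, hmem (-t), ?_, ?_, ?_⟩
  · rw [hdet]
    linear_combination ht - t ^ 2 * hs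
  · rw [hdet]
    linear_combination ht' - t ^ 2 * hs
  · module

theorem convex_LSet (E : Submodule ℝ V3) (Λ : E →ₗ[ℝ] End3) : Convex ℝ (LSet E Λ) := by
  intro L hL M hM a b _ _ hab x
  change a • L x + b • M x = Λ x
  rw [hL x, hM x]
  ext v : 1
  change a • Λ x v + b • Λ x v = Λ x v
  rw [← add_smul, hab, one_smul]

theorem convexHull_eq_of_forall_midpoint {A B : Set Hom3}
    (hB : Convex ℝ B) (hAB : A ⊆ B)
    (h : ∀ x ∈ B, ∃ y ∈ A, ∃ z ∈ A, x = (2 : ℝ)⁻¹ • (y + z)) : convexHull ℝ A = B := by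
  refine (convexHull_min hAB hB).antisymm fun x hx ↦ ?_
  obtain ⟨y, hy, z, hz, rfl⟩ := h x hx
  rw [show (2 : ℝ)⁻¹ • (y + z) = (2 : ℝ)⁻¹ • y + (2 : ℝ)⁻¹ • z by module]
  exact convex_convexHull ℝ A (subset_convexHull ℝ A hy) (subset_convexHull ℝ A hz)
    (by norm_num) (by norm_num) (by norm_num)

/-- Every `L ∈ ℒ` is the midpoint of two elements of the positive-determinant part of `ℒ`,
and likewise of the negative-determinant part; consequently the convex hull of each of these
two sets equals `ℒ`. -/
theorem LSet_convexHull_of_pos_neg_det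
    (S : V3 →ₗ[ℝ] V3 →ₗ[ℝ] V3) (hS : ∀ u v : V3, S u v = - S v u)
    (E : Submodule ℝ V3) (hE : E = Submodule.span ℝ {e2, e3})
    (h2 : e2 ∈ E) (h3 : e3 ∈ E)
    (Λ : E →ₗ[ℝ] End3)
    (hΛ : S e2 e3 + Λ ⟨e2, h2⟩ e3 - Λ ⟨e3, h3⟩ e2 ≠ 0) :
    (∀ L ∈ LSet E Λ,
      (∃ L' ∈ {L ∈ LSet E Λ | 0 < det3 (TT S L e2 e3) (TT S L e3 e1) (TT S L e1 e2)},
       ∃ L'' ∈ {L ∈ LSet E Λ | 0 < det3 (TT S L e2 e3) (TT S L e3 e1) (TT S L e1 e2)},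
        L = (2:ℝ)⁻¹ • (L' + L'')) ∧
      (∃ L' ∈ {L ∈ LSet E Λ | det3 (TT S L e2 e3) (TT S L e3 e1) (TT S L e1 e2) < 0},
       ∃ L'' ∈ {L ∈ LSet E Λ | det3 (TT S L e2 e3) (TT S L e3 e1) (TT S L e1 e2) < 0},
        L = (2:ℝ)⁻¹ • (L' + L''))) ∧
    convexHull ℝ
        {L ∈ LSet E Λ | 0 < det3 (TT S L e2 e3) (TT S L e3 e1) (TT S L e1 e2)} =
      LSet E Λ ∧
    convexHull ℝ
        {L ∈ LSet E Λ | det3 (TT S L e2 e3) (TT S L e3 e1) (TT S L e1 e2) < 0} =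
      LSet E Λ := by
  subst hE
  have hT (L) (hL : L ∈ LSet _ Λ) : TT S L e2 e3 ≠ 0 := by
    rwa [← hL ⟨e2, h2⟩, ← hL ⟨e3, h3⟩] at hΛ
  have hpos (L) (hL : L ∈ LSet _ Λ) :
      ∃ L' ∈ {L ∈ LSet _ Λ | 0 < det3 (TT S L e2 e3) (TT S L e3 e1) (TT S L e1 e2)},
      ∃ L'' ∈ {L ∈ LSet _ Λ | 0 < det3 (TT S L e2 e3) (TT S L e3 e1) (TT S L e1 e2)},
        L = (2:ℝ)⁻¹ • (L' + L'') := by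
    obtain ⟨L', h', L'', h'', hd', hd'', hm⟩ :=
      exists_midpoint_det3_pos S Λ hL (hT L hL) (s := 1) (by norm_num)
    exact ⟨L', ⟨h', by linarith⟩, L'', ⟨h'', by linarith⟩, hm⟩
  have hneg (L) (hL : L ∈ LSet _ Λ) :
      ∃ L' ∈ {L ∈ LSet _ Λ | det3 (TT S L e2 e3) (TT S L e3 e1) (TT S L e1 e2) < 0},
      ∃ L'' ∈ {L ∈ LSet _ Λ | det3 (TT S L e2 e3) (TT S L e3 e1) (TT S L e1 e2) < 0},
        L = (2:ℝ)⁻¹ • (L' + L'') := by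
    obtain ⟨L', h', L'', h'', hd', hd'', hm⟩ :=
      exists_midpoint_det3_pos S Λ hL (hT L hL) (s := -1) (by norm_num)
    exact ⟨L', ⟨h', by linarith⟩, L'', ⟨h'', by linarith⟩, hm⟩
  exact ⟨fun L hL ↦ ⟨hpos L hL, hneg L hL⟩,
    convexHull_eq_of_forall_midpoint (convex_LSet _ Λ) (fun _ h ↦ h.1) hpos,
    convexHull_eq_of_forall_midpoint (convex_LSet _ Λ) (fun _ h ↦ h.1) hneg⟩
end

section
/- Let v₁, v₂, v₃ ∈ ℝ³ be linearly independent vectors and let f : ℝ³ → ℍ be a smooth map that is ℤ³-periodic, i.e. f(x + m) = f(x) for all x ∈ ℝ³ and m ∈ ℤ³. If f satisfies the Fueter equation i·(Df(x)v₁) + j·(Df(x)v₂) + k·(Df(x)v₃) = 0 for all x ∈ ℝ³, where Df(x)v denotes the directional derivative of f at x in direction v, then f is constant. (This expresses that every constant linearly independent triple of vector fields on the 3-torus ℝ³/ℤ³ is a regular divergence free frame.) -/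
noncomputable section

/-- The quaternion units `i`, `j`, `k`. -/
def qi : Quaternion ℝ := ⟨0, 1, 0, 0⟩
def qj : Quaternion ℝ := ⟨0, 0, 1, 0⟩
def qk : Quaternion ℝ := ⟨0, 0, 0, 1⟩

open MeasureTheory Set
open scoped RealInnerProductSpace

/-- A directional derivative of a periodic function integrates to zero over a unit cube. -/
theorem integral_fderiv_apply_eq_zero_of_periodic {n : ℕ} {g : (Fin (n + 1) → ℝ) → ℝ}
    (hg : ContDiff ℝ 1 g) (hper : ∀ i x, g (x + Pi.single i 1) = g x)
    (a v : Fin (n + 1) → ℝ) :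
    ∫ x in Icc a (a + 1), fderiv ℝ g x v = 0 := by
  have hv (x : Fin (n + 1) → ℝ) :
      ∑ i, (v i • fderiv ℝ g x) (Pi.single i 1) = fderiv ℝ g x v := by
    conv_rhs => rw [pi_eq_sum_univ' v, map_sum]
    simp
  have hcont : Continuous fun x => fderiv ℝ g x v :=
    (hg.continuous_fderiv one_ne_zero).clm_apply continuous_const
  have hdiv := integral_divergence_of_hasFDerivAt_off_countable' a (a + 1)
    (by intro i; simp) (fun i x => v i • g x) (fun i x => v i • fderiv ℝ g x) ∅
    countable_empty (fun i => (hg.continuous.const_smul (v i)).continuousOn)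
    (fun x _ i => ((hg.differentiable one_ne_zero x).hasFDerivAt).const_smul (v i))
    (by simpa only [hv] using hcont.continuousOn.integrableOn_compact isCompact_Icc)
  simp only [hv] at hdiv
  rw [hdiv]
  refine Finset.sum_eq_zero fun i _ => sub_eq_zero.2 ?_
  refine integral_congr_ae (.of_forall fun x => ?_)
  have hface : i.insertNth ((a + 1) i) x =
      (i.insertNth (a i) x : Fin (n + 1) → ℝ) + Pi.single i 1 := by
    ext j
    refine i.succAboveCases ?_ (fun j => ?_) j <;> simp
  simp only [hface, hper]

/-- A continuous nonnegative function whose integral over every unit cube vanishes is zero. -/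
theorem eq_zero_of_integral_unit_cube_eq_zero {n : ℕ} {h : (Fin n → ℝ) → ℝ}
    (hc : Continuous h) (h0 : ∀ x, 0 ≤ h x)
    (hint : ∀ a : Fin n → ℝ, ∫ x in Icc a (a + 1), h x = 0) (x : Fin n → ℝ) : h x = 0 := by
  set a : Fin n → ℝ := fun i => x i - 1 / 2 with ha
  have hae := (setIntegral_eq_zero_iff_of_nonneg_ae (.of_forall h0)
    (hc.continuousOn.integrableOn_compact isCompact_Icc)).1 (hint a)
  have hsub : (univ.pi fun i => Ioo (a i) (a i + 1)) ⊆ Icc a (a + 1) := fun y hy =>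
    ⟨fun i => (hy i trivial).1.le, fun i => (hy i trivial).2.le⟩
  refine Measure.eqOn_open_of_ae_eq (ae_restrict_of_ae_restrict_of_subset hsub hae)
    (isOpen_set_pi finite_univ fun i _ => isOpen_Ioo) hc.continuousOn continuousOn_const
    fun i _ => ?_
  constructor <;> simp only [ha] <;> linarith

section Fueter

variable {E : Type*} [NormedAddCommGroup E] [NormedSpace ℝ E]

theorem fderiv_fderiv_apply {F : Type*} [NormedAddCommGroup F] [NormedSpace ℝ F] {f : E → F}
    (hf : ContDiff ℝ 2 f) (x v w : E) :
    fderiv ℝ (fun y => fderiv ℝ f y v) x w = fderiv ℝ (fderiv ℝ f) x w v := by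
  have hd : DifferentiableAt ℝ (fderiv ℝ f) x :=
    (hf.fderiv_right (m := 1) (by norm_num)).differentiable one_ne_zero x
  rw [fderiv_clm_apply hd (differentiableAt_const v)]
  simp

/-- The square of the Fueter operator of a constant frame is minus the Laplacian of the frame. -/
theorem laplacian_eq_zero_of_fueter {f : E → Quaternion ℝ} (hf : ContDiff ℝ 2 f) {v₁ v₂ v₃ : E}
    (hfueter : ∀ x,
      qi * (fderiv ℝ f x v₁) + qj * (fderiv ℝ f x v₂) + qk * (fderiv ℝ f x v₃) = 0) (x : E) :
    fderiv ℝ (fderiv ℝ f) x v₁ v₁ + fderiv ℝ (fderiv ℝ f) x v₂ v₂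
      + fderiv ℝ (fderiv ℝ f) x v₃ v₃ = 0 := by
  have hd (v : E) : DifferentiableAt ℝ (fun y => fderiv ℝ f y v) x :=
    ((hf.fderiv_right (m := 1) (by norm_num)).differentiable one_ne_zero x).clm_apply
      (differentiableAt_const v)
  have hsymm : IsSymmSndFDerivAt ℝ f x := hf.contDiffAt.isSymmSndFDerivAt (by simp)
  have hderiv (w : E) : qi * fderiv ℝ (fderiv ℝ f) x w v₁ + qj * fderiv ℝ (fderiv ℝ f) x w v₂
      + qk * fderiv ℝ (fderiv ℝ f) x w v₃ = 0 := by
    have h := ((((hd v₁).hasFDerivAt.const_mul qi).add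
      ((hd v₂).hasFDerivAt.const_mul qj)).add ((hd v₃).hasFDerivAt.const_mul qk)).fderiv
    have hzero : ((fun y => qi * fderiv ℝ f y v₁) + (fun y => qj * fderiv ℝ f y v₂)
        + fun y => qk * fderiv ℝ f y v₃) = fun _ => 0 := funext hfueter
    rw [hzero] at h
    simpa [fderiv_fderiv_apply hf] using (DFunLike.congr_fun h w).symm
  have h₁ := hderiv v₁
  have h₂ := hderiv v₂
  have h₃ := hderiv v₃
  rw [hsymm v₂ v₁] at h₂
  rw [hsymm v₃ v₁, hsymm v₃ v₂] at h₃
  simp only [Quaternion.ext_iff, Quaternion.re_add, Quaternion.imI_add, Quaternion.imJ_add,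
    Quaternion.imK_add, Quaternion.re_mul, Quaternion.imI_mul, Quaternion.imJ_mul,
    Quaternion.imK_mul, Quaternion.re_zero, Quaternion.imI_zero, Quaternion.imJ_zero,
    Quaternion.imK_zero] at h₁ h₂ h₃ ⊢
  simp only [qi, qj, qk] at h₁ h₂ h₃
  obtain ⟨_, _, _, _⟩ := h₁
  obtain ⟨_, _, _, _⟩ := h₂
  obtain ⟨_, _, _, _⟩ := h₃
  refine ⟨?_, ?_, ?_, ?_⟩ <;> linarith

end Fueter

/-- If `f` is periodic and harmonic for the constant metric determined by the vectors `v i`, then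
its derivatives along the `v i` vanish. -/
theorem fderiv_apply_eq_zero_of_periodic_of_laplacian_eq_zero {n : ℕ} {ι F : Type*} [Fintype ι]
    [NormedAddCommGroup F] [InnerProductSpace ℝ F] {f : (Fin (n + 1) → ℝ) → F}
    (hf : ContDiff ℝ 2 f) (hper : ∀ i x, f (x + Pi.single i 1) = f x)
    (v : ι → Fin (n + 1) → ℝ) (hlap : ∀ x, ∑ k, fderiv ℝ (fderiv ℝ f) x (v k) (v k) = 0)
    (x : Fin (n + 1) → ℝ) (k : ι) : fderiv ℝ f x (v k) = 0 := by
  have hf' : ContDiff ℝ 1 (fderiv ℝ f) := hf.fderiv_right (by norm_num)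
  have hf1 : ContDiff ℝ 1 f := hf.of_le (by norm_num)
  have hdv (w) : ContDiff ℝ 1 fun x => fderiv ℝ f x w := hf'.clm_apply contDiff_const
  have hg (w) : ContDiff ℝ 1 fun x => ⟪f x, fderiv ℝ f x w⟫ := hf1.inner ℝ (hdv w)
  have hper' (i x) : fderiv ℝ f (x + Pi.single i 1) = fderiv ℝ f x := by
    rw [← fderiv_comp_add_right]
    simp only [hper]
  have hint (w a) := integral_fderiv_apply_eq_zero_of_periodic (hg w)
    (fun i x => by simp only [hper, hper']) a w
  have hgrad (x) : ∑ k, fderiv ℝ (fun x => ⟪f x, fderiv ℝ f x (v k)⟫) x (v k) =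
      ∑ k, ‖fderiv ℝ f x (v k)‖ ^ 2 := by
    simp_rw [fderiv_inner_apply ℝ (hf1.differentiable one_ne_zero x)
      ((hdv _).differentiable one_ne_zero x), fderiv_fderiv_apply hf, Finset.sum_add_distrib,
      ← inner_sum, hlap, inner_zero_right, zero_add, real_inner_self_eq_norm_sq]
  have hzero := eq_zero_of_integral_unit_cube_eq_zero
    (h := fun x => ∑ k, ‖fderiv ℝ f x (v k)‖ ^ 2)
    (continuous_finsetSum _ fun k _ => (hdv (v k)).continuous.norm.pow 2)
    (fun x => Finset.sum_nonneg fun k _ => sq_nonneg _)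
    (fun a => by
      simp only [← hgrad]
      rw [integral_finsetSum _ fun k _ => ?_]
      · exact Finset.sum_eq_zero fun k _ => hint (v k) a
      · exact (((hg (v k)).continuous_fderiv one_ne_zero).clm_apply
          continuous_const).continuousOn.integrableOn_compact isCompact_Icc) x
  simpa using (Finset.sum_eq_zero_iff_of_nonneg fun k _ => sq_nonneg _).1 hzero k
    (Finset.mem_univ k)

/-- Every smooth `ℤ³`-periodic solution of the Fueter equation on `ℝ³` associated to a
constant linearly independent frame `v₁, v₂, v₃` is constant: every constant linearly
independent frame on the `3`-torus is a regular divergence free frame. -/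
theorem fueter_periodic_constant_frame_implies_constant
    (v₁ v₂ v₃ : Fin 3 → ℝ) (hv : LinearIndependent ℝ ![v₁, v₂, v₃])
    (f : (Fin 3 → ℝ) → Quaternion ℝ) (hf : ContDiff ℝ (⊤ : ℕ∞) f)
    (hper : ∀ (x : Fin 3 → ℝ) (m : Fin 3 → ℤ), f (x + fun i => (m i : ℝ)) = f x)
    (hfueter : ∀ x : Fin 3 → ℝ,
      qi * (fderiv ℝ f x v₁) + qj * (fderiv ℝ f x v₂) + qk * (fderiv ℝ f x v₃) = 0) :
    ∃ c : Quaternion ℝ, ∀ x, f x = c := by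
  have hf2 : ContDiff ℝ 2 f := contDiff_infty.1 hf 2
  have hper' (i : Fin 3) (x : Fin 3 → ℝ) : f (x + Pi.single i 1) = f x := by
    convert hper x (Pi.single i 1) using 3
    ext j
    by_cases h : j = i <;> simp [h]
  have hzero := fderiv_apply_eq_zero_of_periodic_of_laplacian_eq_zero hf2 hper' ![v₁, v₂, v₃]
    fun x => by simpa [Fin.sum_univ_three] using laplacian_eq_zero_of_fueter hf2 hfueter x
  have hspan := hv.span_eq_top_of_card_eq_finrank (by simp)
  refine ⟨f 0, fun x => is_const_of_fderiv_eq_zero (𝕜 := ℝ) (hf2.differentiable two_ne_zero)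
    (fun y => ContinuousLinearMap.coe_injective (LinearMap.ext_on_range hspan fun k => ?_)) x 0⟩
  simpa using hzero y k

end
end

section
/- Let U ⊆ ℝ³ be open, let v₁, v₂, v₃ : U → ℝ³ be smooth vector fields, and let f : U → ℍ be smooth. For vector fields u, v define the bracket [u,v](x) := (Du(x))(v(x)) − (Dv(x))(u(x)), and set w₁ := [v₂,v₃], w₂ := [v₃,v₁], w₃ := [v₁,v₂]. Then on U one has the identity ∂̸_v(∂̸_v f) = −(∂_{v₁}∂_{v₁}f + ∂_{v₂}∂_{v₂}f + ∂_{v₃}∂_{v₃}f) − ∂̸_w f, where ∂̸_v f := i·∂_{v₁}f + j·∂_{v₂}f + k·∂_{v₃}f and ∂̸_w f := i·∂_{w₁}f + j·∂_{w₂}f + k·∂_{w₃}f. -/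
noncomputable section

/-- The directional derivative `∂_u g : x ↦ Dg(x)(u(x))` of a map `g` on `ℝ³` along a
vector field `u`. -/
def pd {W : Type*} [NormedAddCommGroup W] [NormedSpace ℝ W]
    (u : (Fin 3 → ℝ) → (Fin 3 → ℝ)) (g : (Fin 3 → ℝ) → W) : (Fin 3 → ℝ) → W :=
  fun x => fderiv ℝ g x (u x)

/-- The Lie bracket `[u,v](x) = (Du(x))(v(x)) − (Dv(x))(u(x))` of two vector fields. -/
def bracket (u v : (Fin 3 → ℝ) → (Fin 3 → ℝ)) : (Fin 3 → ℝ) → (Fin 3 → ℝ) :=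
  fun x => pd v u x - pd u v x

/-- The Fueter operator `∂̸_v f = i·∂_{v₁}f + j·∂_{v₂}f + k·∂_{v₃}f` associated to a triple
of vector fields on `ℝ³`. -/
def fueterOp (v₁ v₂ v₃ : (Fin 3 → ℝ) → (Fin 3 → ℝ))
    (f : (Fin 3 → ℝ) → Quaternion ℝ) : (Fin 3 → ℝ) → Quaternion ℝ :=
  fun x => qi * pd v₁ f x + qj * pd v₂ f x + qk * pd v₃ f x

theorem differentiableAt_pd {W : Type*} [NormedAddCommGroup W] [NormedSpace ℝ W]
    {u : (Fin 3 → ℝ) → (Fin 3 → ℝ)} {g : (Fin 3 → ℝ) → W} {x : Fin 3 → ℝ}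
    (hu : DifferentiableAt ℝ u x) (hg : ContDiffAt ℝ 2 g x) :
    DifferentiableAt ℝ (pd u g) x :=
  ((hg.fderiv_right (m := 1) (by norm_num)).differentiableAt (by norm_num)).clm_apply hu

/-- With this sign convention, `∂_{[u,v]} g = ∂_v ∂_u g − ∂_u ∂_v g`. -/
theorem pd_bracket {W : Type*} [NormedAddCommGroup W] [NormedSpace ℝ W]
    {u v : (Fin 3 → ℝ) → (Fin 3 → ℝ)} {g : (Fin 3 → ℝ) → W} {x : Fin 3 → ℝ}
    (hu : DifferentiableAt ℝ u x) (hv : DifferentiableAt ℝ v x) (hg : ContDiffAt ℝ 2 g x) :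
    pd (bracket u v) g x = pd v (pd u g) x - pd u (pd v g) x :=
  VectorField.fderiv_apply_lieBracket hg (by simp) hu hv

/-- The derivative of a Fueter operator along a vector field, termwise. -/
theorem pd_fueterOp {u v₁ v₂ v₃ : (Fin 3 → ℝ) → (Fin 3 → ℝ)}
    {f : (Fin 3 → ℝ) → Quaternion ℝ} {x : Fin 3 → ℝ}
    (h₁ : DifferentiableAt ℝ (pd v₁ f) x) (h₂ : DifferentiableAt ℝ (pd v₂ f) x)
    (h₃ : DifferentiableAt ℝ (pd v₃ f) x) :
    pd u (fueterOp v₁ v₂ v₃ f) x =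
      qi * pd u (pd v₁ f) x + qj * pd u (pd v₂ f) x + qk * pd u (pd v₃ f) x := by
  have h := ((h₁.hasFDerivAt.const_mul qi).add (h₂.hasFDerivAt.const_mul qj)).add
    (h₃.hasFDerivAt.const_mul qk)
  exact congrArg (fun L => L (u x)) h.fderiv

/-- The square of the Fueter operator: `∂̸_v ∂̸_v f = −(∑ᵢ ∂_{vᵢ}∂_{vᵢ} f) − ∂̸_w f`, where
`w₁ = [v₂,v₃]`, `w₂ = [v₃,v₁]`, `w₃ = [v₁,v₂]`. -/
theorem fueter_squared
    (U : Set (Fin 3 → ℝ)) (hU : IsOpen U)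
    (v₁ v₂ v₃ : (Fin 3 → ℝ) → (Fin 3 → ℝ))
    (hv₁ : ContDiffOn ℝ (⊤ : ℕ∞) v₁ U) (hv₂ : ContDiffOn ℝ (⊤ : ℕ∞) v₂ U)
    (hv₃ : ContDiffOn ℝ (⊤ : ℕ∞) v₃ U)
    (f : (Fin 3 → ℝ) → Quaternion ℝ) (hf : ContDiffOn ℝ (⊤ : ℕ∞) f U) :
    ∀ x ∈ U,
      fueterOp v₁ v₂ v₃ (fueterOp v₁ v₂ v₃ f) x =
        -(pd v₁ (pd v₁ f) x + pd v₂ (pd v₂ f) x + pd v₃ (pd v₃ f) x) -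
          fueterOp (bracket v₂ v₃) (bracket v₃ v₁) (bracket v₁ v₂) f x := by
  intro x hx
  have hnhds : U ∈ nhds x := hU.mem_nhds hx
  have h₁ : DifferentiableAt ℝ v₁ x := (hv₁.contDiffAt hnhds).differentiableAt (by simp)
  have h₂ : DifferentiableAt ℝ v₂ x := (hv₂.contDiffAt hnhds).differentiableAt (by simp)
  have h₃ : DifferentiableAt ℝ v₃ x := (hv₃.contDiffAt hnhds).differentiableAt (by simp)
  have hf₂ : ContDiffAt ℝ 2 f x := (hf.contDiffAt hnhds).of_le (WithTop.coe_le_coe.2 le_top)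
  have hp (u) : pd u (fueterOp v₁ v₂ v₃ f) x =
      qi * pd u (pd v₁ f) x + qj * pd u (pd v₂ f) x + qk * pd u (pd v₃ f) x :=
    pd_fueterOp (differentiableAt_pd h₁ hf₂) (differentiableAt_pd h₂ hf₂)
      (differentiableAt_pd h₃ hf₂)
  rw [fueterOp, fueterOp, hp, hp, hp, pd_bracket h₂ h₃ hf₂, pd_bracket h₃ h₁ hf₂,
    pd_bracket h₁ h₂ hf₂]
  ext <;> simp <;> simp [qi, qj, qk] <;> ring

end
end

section
/- Let v₁, v₂, v₃ : ℝ³ → ℝ³ be smooth ℤ³-periodic vector fields that are divergence free, i.e. the trace of the Jacobian Dv_m(x) vanishes for all x and m = 1,2,3. Then the Fueter operator ∂̸_v is symmetric with respect to the L² inner product: for all smooth ℤ³-periodic maps f, g : ℝ³ → ℍ one has ∫_{[0,1]³} ⟨∂̸_v f, g⟩ dx = ∫_{[0,1]³} ⟨f, ∂̸_v g⟩ dx, where ⟨·,·⟩ is the standard real inner product on ℍ ≅ ℝ⁴. -/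
open scoped RealInnerProductSpace
open MeasureTheory

noncomputable section

/-- A map on `ℝ³` is `ℤ³`-periodic. -/
def ZPeriodic {W : Type*} (g : (Fin 3 → ℝ) → W) : Prop :=
  ∀ (x : Fin 3 → ℝ) (m : Fin 3 → ℤ), g (x + fun i => (m i : ℝ)) = g x

/-- A vector field on `ℝ³` is divergence free: the trace of its Jacobian vanishes. -/
def DivergenceFree (u : (Fin 3 → ℝ) → (Fin 3 → ℝ)) : Prop :=
  ∀ x : Fin 3 → ℝ, LinearMap.trace ℝ (Fin 3 → ℝ) (fderiv ℝ u x).toLinearMap = 0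

/-- The integral over a fundamental domain of the derivative of a periodic function along a
periodic divergence free vector field vanishes. -/
theorem integral_pd_eq_zero {u : (Fin 3 → ℝ) → (Fin 3 → ℝ)} {h : (Fin 3 → ℝ) → ℝ}
    (hu : ContDiff ℝ 1 u) (hh : ContDiff ℝ 1 h) (hup : ZPeriodic u) (hhp : ZPeriodic h)
    (hud : DivergenceFree u) :
    ∫ x in Set.Icc (0 : Fin 3 → ℝ) 1, pd u h x = 0 := by
  have hd (x : Fin 3 → ℝ) : HasFDerivAt (fun x => h x • u x)
      (h x • fderiv ℝ u x + (fderiv ℝ h x).smulRight (u x)) x :=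
    (hh.differentiable one_ne_zero x).hasFDerivAt.smul
      (hu.differentiable one_ne_zero x).hasFDerivAt
  have hdiv (x : Fin 3 → ℝ) :
      ∑ i, (h x • fderiv ℝ u x + (fderiv ℝ h x).smulRight (u x)) (Pi.single i 1) i =
        pd u h x := by
    have htr : ∑ i, fderiv ℝ u x (Pi.single i 1) i = 0 := by
      rw [← hud x, LinearMap.trace_eq_matrix_trace ℝ (Pi.basisFun ℝ (Fin 3))]
      simp [Matrix.trace]
    have hsum : pd u h x = ∑ i, fderiv ℝ h x (Pi.single i 1) * u x i := by
      conv_lhs => rw [pd, pi_eq_sum_univ' (u x), map_sum]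
      refine Finset.sum_congr rfl fun i _ => ?_
      rw [map_smul, smul_eq_mul, mul_comm]
    simp [Finset.sum_add_distrib, ← Finset.mul_sum, htr, hsum]
  have hcont : Continuous (pd u h) :=
    (hh.continuous_fderiv one_ne_zero).clm_apply hu.continuous
  have key := integral_divergence_of_hasFDerivAt_off_countable (0 : Fin 3 → ℝ) 1 zero_le_one
    (fun x => h x • u x) _ ∅ Set.countable_empty
    (hh.continuous.smul hu.continuous).continuousOn (fun x _ => hd x)
    (by simpa only [hdiv] using hcont.continuousOn.integrableOn_compact isCompact_Icc)
  simp only [hdiv] at key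
  rw [key]
  refine Finset.sum_eq_zero fun i _ => sub_eq_zero.2 <| integral_congr_ae <| .of_forall fun y => ?_
  have hface : i.insertNth ((1 : Fin 3 → ℝ) i) y =
      i.insertNth ((0 : Fin 3 → ℝ) i) y + fun j => (((Pi.single i 1 : Fin 3 → ℤ) j : ℤ) : ℝ) := by
    ext j
    refine Fin.succAboveCases i ?_ (fun k => ?_) j <;> simp
  simp only [hface, hup _ _, hhp _ _]

/-- Left multiplication by an imaginary quaternion is skew-adjoint, so the defect of symmetry of
`q · ∂_u` is a derivative along `u`. -/
theorem inner_mul_pd_sub_inner_mul_pd {q : Quaternion ℝ} (hq : q.re = 0)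
    (u : (Fin 3 → ℝ) → (Fin 3 → ℝ)) {f g : (Fin 3 → ℝ) → Quaternion ℝ}
    (hf : Differentiable ℝ f) (hg : Differentiable ℝ g) (x : Fin 3 → ℝ) :
    ⟪q * pd u f x, g x⟫ - ⟪f x, q * pd u g x⟫ = pd u (fun y => ⟪q * f y, g y⟫) x := by
  have hskew (a b : Quaternion ℝ) : ⟪a, q * b⟫ = -⟪q * a, b⟫ := by
    simp [Quaternion.inner_def, hq]
    ring
  have hd := ((hf x).hasFDerivAt.const_mul q).inner ℝ (hg x).hasFDerivAt
  simp only [pd]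
  rw [hd.fderiv, hskew]
  simp [add_comm]

/-- The Fueter operator of a divergence free triple of periodic vector fields is symmetric
with respect to the `L²` inner product over the fundamental domain `[0,1]³`. -/
theorem fueterOp_symmetric_of_divergenceFree
    (v₁ v₂ v₃ : (Fin 3 → ℝ) → (Fin 3 → ℝ))
    (hv₁s : ContDiff ℝ (⊤ : ℕ∞) v₁) (hv₂s : ContDiff ℝ (⊤ : ℕ∞) v₂) (hv₃s : ContDiff ℝ (⊤ : ℕ∞) v₃)
    (hv₁p : ZPeriodic v₁) (hv₂p : ZPeriodic v₂) (hv₃p : ZPeriodic v₃)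
    (hv₁d : DivergenceFree v₁) (hv₂d : DivergenceFree v₂) (hv₃d : DivergenceFree v₃)
    (f g : (Fin 3 → ℝ) → Quaternion ℝ)
    (hfs : ContDiff ℝ (⊤ : ℕ∞) f) (hgs : ContDiff ℝ (⊤ : ℕ∞) g)
    (hfp : ZPeriodic f) (hgp : ZPeriodic g) :
    ∫ x in Set.Icc (0 : Fin 3 → ℝ) 1, ⟪fueterOp v₁ v₂ v₃ f x, g x⟫ =
      ∫ x in Set.Icc (0 : Fin 3 → ℝ) 1, ⟪f x, fueterOp v₁ v₂ v₃ g x⟫ := by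
  have hf := hfs.of_le (m := 1) (by exact_mod_cast le_top)
  have hg := hgs.of_le (m := 1) (by exact_mod_cast le_top)
  have hv₁ := hv₁s.of_le (m := 1) (by exact_mod_cast le_top)
  have hv₂ := hv₂s.of_le (m := 1) (by exact_mod_cast le_top)
  have hv₃ := hv₃s.of_le (m := 1) (by exact_mod_cast le_top)
  have hh (q : Quaternion ℝ) : ContDiff ℝ 1 fun y => ⟪q * f y, g y⟫ :=
    (contDiff_const.mul hf).inner ℝ hg
  have hhp (q : Quaternion ℝ) : ZPeriodic fun y => ⟪q * f y, g y⟫ := fun x m => by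
    simp only [hfp x m, hgp x m]
  have hpd {W : Type} [NormedAddCommGroup W] [NormedSpace ℝ W] {u : (Fin 3 → ℝ) → (Fin 3 → ℝ)}
      {h : (Fin 3 → ℝ) → W} (hu : ContDiff ℝ 1 u) (hh : ContDiff ℝ 1 h) : Continuous (pd u h) :=
    (hh.continuous_fderiv one_ne_zero).clm_apply hu.continuous
  have hint {h : (Fin 3 → ℝ) → ℝ} (hc : Continuous h) :
      IntegrableOn h (Set.Icc (0 : Fin 3 → ℝ) 1) :=
    hc.continuousOn.integrableOn_compact isCompact_Icc
  have hfueter {h : (Fin 3 → ℝ) → Quaternion ℝ} (hh : ContDiff ℝ 1 h) :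
      Continuous (fueterOp v₁ v₂ v₃ h) :=
    ((continuous_const.mul (hpd hv₁ hh)).add (continuous_const.mul (hpd hv₂ hh))).add
      (continuous_const.mul (hpd hv₃ hh))
  have hdiff (x : Fin 3 → ℝ) :
      ⟪fueterOp v₁ v₂ v₃ f x, g x⟫ - ⟪f x, fueterOp v₁ v₂ v₃ g x⟫ =
        pd v₁ (fun y => ⟪qi * f y, g y⟫) x + pd v₂ (fun y => ⟪qj * f y, g y⟫) x +
          pd v₃ (fun y => ⟪qk * f y, g y⟫) x := by
    have hfd := hf.differentiable one_ne_zero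
    have hgd := hg.differentiable one_ne_zero
    rw [← inner_mul_pd_sub_inner_mul_pd (q := qi) rfl v₁ hfd hgd,
      ← inner_mul_pd_sub_inner_mul_pd (q := qj) rfl v₂ hfd hgd,
      ← inner_mul_pd_sub_inner_mul_pd (q := qk) rfl v₃ hfd hgd]
    simp only [fueterOp, inner_add_left, inner_add_right]
    ring
  rw [← sub_eq_zero, ← integral_sub (hint ((hfueter hf).inner hg.continuous))
    (hint (hf.continuous.inner (hfueter hg)))]
  simp only [hdiff]
  have h₁ := hint (hpd hv₁ (hh qi))
  have h₂ := hint (hpd hv₂ (hh qj))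
  have h₃ := hint (hpd hv₃ (hh qk))
  rw [integral_add (by exact h₁.add h₂) h₃, integral_add h₁ h₂,
    integral_pd_eq_zero hv₁ (hh qi) hv₁p (hhp qi) hv₁d,
    integral_pd_eq_zero hv₂ (hh qj) hv₂p (hhp qj) hv₂d,
    integral_pd_eq_zero hv₃ (hh qk) hv₃p (hhp qk) hv₃d]
  simp

end
end
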